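/- arXiv:gr-qc/0004008 — 2 statements merged into one kernel-verified Lean document; each statement's English description precedes it below -/
import Mathlib

section
/- (Pseudo-functions restricted to test functions are Schwartz distributions.) Let F ∈ 𝓕. For every φ ∈ C_c^∞(ℝ³) the Hadamard partie finie Pf_{s₁,s₂} ∫ F φ d³x exists; the map ⟨PfF, φ⟩ := Pf_{s₁,s₂} ∫ F φ d³x is linear in φ; and it is continuous in the sense of Schwartz test-function convergence: if K ⊂ ℝ³ is compact and (φ_n) is a sequence in C_c^∞(ℝ³) with supp φ_n ⊂ K for all n and with ∂_Lφ_n → 0 uniformly on ℝ³ for every multi-index L (including L = ∅), then ⟨PfF, φ_n⟩ → 0. -/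
open MeasureTheory Filter Topology Real Asymptotics

noncomputable section

abbrev E3 : Type := EuclideanSpace ℝ (Fin 3)
abbrev S2 : Type := Metric.sphere (0 : E3) 1

/-- The surface measure `dΩ` on the unit sphere `S²` (total mass `4π`). -/
def dOmega : Measure S2 := (volume : Measure E3).toSphere

/-- A function on the unit sphere is smooth iff it is the restriction of
a smooth function on `ℝ³`. -/
def SmoothSphereFn (f : S2 → ℝ) : Prop :=
  ∃ g : E3 → ℝ, ContDiff ℝ (⊤ : ℕ∞) g ∧ ∀ n : S2, g (n : E3) = f n

/-- `F` admits a power-like singular expansion at `y` with coefficients `c`: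
the family of exponents (the `a`'s with `c a ≠ 0`) is bounded below, with only
finitely many exponents below any given bound, the coefficients are smooth
functions on the sphere, and for every `N`, `F(y + r n) = Σ_{a ≤ N} r^a (c a)(n)
+ o(r^N)` as `r → 0⁺`, uniformly in `n ∈ S²`. -/
structure HasSingExpansion (y : E3) (F : E3 → ℝ) (c : ℝ → S2 → ℝ) : Prop where
  smooth_coeffs : ∀ a : ℝ, SmoothSphereFn (c a)
  bddBelow : ∃ a₀ : ℝ, ∀ a : ℝ, a < a₀ → c a = 0
  finite_exponents : ∀ N : ℝ, {a : ℝ | a ≤ N ∧ c a ≠ 0}.Finite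
  expansion : ∀ N : ℕ, ∀ ε > 0, ∃ δ > 0, ∀ r : ℝ, 0 < r → r < δ → ∀ n : S2,
    |F (y + r • (n : E3)) - ∑ᶠ (a : ℝ) (_ : a ≤ (N : ℝ)), r ^ a * c a n| ≤ ε * r ^ (N : ℝ)

/-- The exponents of the singular expansion are integers. -/
def IntegerExponents (c : ℝ → S2 → ℝ) : Prop :=
  ∀ a : ℝ, c a ≠ 0 → ∃ k : ℤ, a = (k : ℝ)

/-- The Hadamard partie finie at the singular point, `(F)_y = (1/4π) ∫_{S²} f₀ dΩ`,
expressed in terms of the expansion coefficients `c` of `F`. -/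
def pfAt (c : ℝ → S2 → ℝ) : ℝ :=
  (4 * π)⁻¹ * ∫ n : S2, c 0 n ∂dOmega

/-- `F` is smooth on a punctured neighbourhood of `y`. -/
def SmoothNearPunctured (y : E3) (F : E3 → ℝ) : Prop :=
  ∃ U ∈ 𝓝 y, ContDiffOn ℝ (⊤ : ℕ∞) F (U \ {y})

/-- The quantity whose limit as `s → 0⁺` defines the Hadamard partie finie
`Pf_{s₁,s₂} ∫ F d³x`: the integral over `ℝ³` minus two balls of radius `s`,
plus the divergent subtractions built from the expansion coefficients `c` at `y₁`
and `d` at `y₂`. -/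
def pfApprox (y₁ y₂ : E3) (s₁ s₂ : ℝ) (F : E3 → ℝ) (c d : ℝ → S2 → ℝ) (s : ℝ) : ℝ :=
  (∫ x in (Metric.closedBall y₁ s ∪ Metric.closedBall y₂ s)ᶜ, F x)
    + (∑ᶠ (a : ℝ) (_ : a < -3), s ^ (a + 3) / (a + 3) * ∫ n : S2, c a n ∂dOmega)
    + Real.log (s / s₁) * (∫ n : S2, c (-3) n ∂dOmega)
    + (∑ᶠ (b : ℝ) (_ : b < -3), s ^ (b + 3) / (b + 3) * ∫ n : S2, d b n ∂dOmega)
    + Real.log (s / s₂) * (∫ n : S2, d (-3) n ∂dOmega)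

/-- `Pf_{s₁,s₂} ∫ F d³x` exists and equals `L`. -/
def HasPfIntegral (y₁ y₂ : E3) (s₁ s₂ : ℝ) (F : E3 → ℝ) (c d : ℝ → S2 → ℝ) (L : ℝ) : Prop :=
  Tendsto (pfApprox y₁ y₂ s₁ s₂ F c d) (𝓝[>] (0 : ℝ)) (𝓝 L)

/-- Membership in the class `𝓕`: smooth outside `{y₁, y₂}` and admitting singular
expansions at `y₁` (coefficients `c`) and `y₂` (coefficients `d`). -/
structure MemF (y₁ y₂ : E3) (F : E3 → ℝ) (c d : ℝ → S2 → ℝ) : Prop where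
  smooth : ContDiffOn ℝ (⊤ : ℕ∞) F ({y₁, y₂}ᶜ : Set E3)
  exp₁ : HasSingExpansion y₁ F c
  exp₂ : HasSingExpansion y₂ F d

/-- The partial derivative `∂_i F` (as a plain function, defined outside the
singularities via `fderiv`). -/
def pder (i : Fin 3) (F : E3 → ℝ) (x : E3) : ℝ :=
  fderiv ℝ F x (EuclideanSpace.single i 1)


instance : IsFiniteMeasure dOmega := by unfold dOmega; infer_instance

open Set in
lemma polar_integral (b s R : ℝ) (hs : 0 < s) (hsR : s < R) (f : E3 → ℝ) :
    ∫ x in Metric.ball (0:E3) R \ Metric.closedBall 0 s, ‖x‖ ^ b * f (‖x‖⁻¹ • x)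
      = (∫ r in s..R, r ^ (b + 2)) * ∫ n : S2, f n ∂dOmega := by
  have hms : MeasurableSet (Metric.ball (0:E3) R \ Metric.closedBall 0 s) :=
    measurableSet_ball.diff measurableSet_closedBall
  rw [← integral_indicator hms]
  have key : ∀ x : E3, (Metric.ball (0:E3) R \ Metric.closedBall 0 s).indicator
      (fun x => ‖x‖ ^ b * f (‖x‖⁻¹ • x)) x
      = f (‖x‖⁻¹ • x) * (Ioo s R).indicator (fun r => r ^ b) ‖x‖ := by
    intro x
    by_cases h1 : ‖x‖ < R <;> by_cases h2 : s < ‖x‖ <;>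
      simp [Set.indicator, h1, h2, mul_comm]
  simp_rw [key]
  calc ∫ x, f (‖x‖⁻¹ • x) * (Ioo s R).indicator (fun r => r ^ b) ‖x‖
      = ∫ x : ({(0)}ᶜ : Set E3), f (‖x.1‖⁻¹ • x.1) *
          (Ioo s R).indicator (fun r => r ^ b) ‖x.1‖ ∂((volume : Measure E3).comap (↑)) := by
        rw [integral_subtype_comap (measurableSet_singleton _).compl
          fun x : E3 ↦ f (‖x‖⁻¹ • x) * (Ioo s R).indicator (fun r => r ^ b) ‖x‖,
          restrict_compl_singleton]
    _ = ∫ z : S2 × Ioi (0:ℝ), f z.1 * (Ioo s R).indicator (fun r => r ^ b) z.2.1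
          ∂((volume : Measure E3).toSphere.prod (.volumeIoiPow (Module.finrank ℝ E3 - 1))) := by
      have := (volume : Measure E3).measurePreserving_homeomorphUnitSphereProd.integral_comp
        (Homeomorph.measurableEmbedding _)
        (fun z : S2 × Ioi (0:ℝ) => f z.1 * (Ioo s R).indicator (fun r => r ^ b) z.2.1)
      rw [← this]
      simp
    _ = (∫ n : S2, f n ∂dOmega) * ∫ r : Ioi (0:ℝ), (Ioo s R).indicator (fun r => r ^ b) r.1
          ∂(.volumeIoiPow (Module.finrank ℝ E3 - 1)) := by
      rw [← integral_prod_mul (fun n : S2 => f n)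
        (fun r : Ioi (0:ℝ) => (Ioo s R).indicator (fun r => r ^ b) r.1)]
      rfl
    _ = _ := by
      rw [mul_comm]
      congr 1
      simp only [Measure.volumeIoiPow, ENNReal.ofReal, finrank_euclideanSpace, Fintype.card_fin]
      rw [integral_withDensity_eq_integral_smul]
      · rw [integral_subtype_comap measurableSet_Ioi
          fun a ↦ Real.toNNReal (a ^ (3 - 1)) • (Ioo s R).indicator (fun r : ℝ => r ^ b) a]
        rw [intervalIntegral.integral_of_le hsR.le, integral_Ioc_eq_integral_Ioo,
          ← integral_indicator measurableSet_Ioi, ← integral_indicator measurableSet_Ioo]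
        congr 1
        ext r
        by_cases h1 : r ∈ Ioo s R
        · have h0 : 0 < r := hs.trans h1.1
          simp only [Set.indicator, h1, Set.mem_Ioi, h0, if_true]
          rw [NNReal.smul_def, Real.coe_toNNReal _ (by positivity), Real.rpow_add h0]
          simp [mul_comm]
        · simp [Set.indicator, h1]
      · exact (measurable_subtype_coe.pow_const _).real_toNNReal

lemma polar_integral' (y : E3) (b s R : ℝ) (hs : 0 < s) (hsR : s < R) (f : E3 → ℝ) :
    ∫ x in Metric.ball y R \ Metric.closedBall y s, ‖x - y‖ ^ b * f (‖x - y‖⁻¹ • (x - y))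
      = (∫ r in s..R, r ^ (b + 2)) * ∫ n : S2, f n ∂dOmega := by
  rw [← polar_integral b s R hs hsR f]
  have hms : MeasurableSet (Metric.ball (0:E3) R \ Metric.closedBall 0 s) :=
    measurableSet_ball.diff measurableSet_closedBall
  have hms' : MeasurableSet (Metric.ball y R \ Metric.closedBall y s) :=
    measurableSet_ball.diff measurableSet_closedBall
  rw [← integral_indicator hms, ← integral_indicator hms']
  rw [← integral_sub_right_eq_self (μ := (volume : Measure E3))
    ((Metric.ball (0:E3) R \ Metric.closedBall 0 s).indicator
      (fun x => ‖x‖ ^ b * f (‖x‖⁻¹ • x))) y]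
  congr 1
  ext x
  simp [Set.indicator, dist_eq_norm]

lemma radial_integral (b s R : ℝ) (hs : 0 < s) (hsR : s < R) :
    (∫ r in s..R, r ^ (b + 2)) =
      if b = -3 then Real.log (R / s) else (R ^ (b + 3) - s ^ (b + 3)) / (b + 3) := by
  have h0 : (0:ℝ) ∉ Set.uIcc s R := by
    rw [Set.uIcc_of_le hsR.le]; simp; intro h; linarith
  split_ifs with h
  · subst h
    rw [← integral_inv_of_pos hs (hs.trans hsR)]
    apply intervalIntegral.integral_congr
    intro r hr
    norm_num [Real.rpow_neg_one]
  · rw [integral_rpow (Or.inr ⟨by intro h'; apply h; linarith, h0⟩)]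
    ring_nf

lemma reindex (A : Finset ℝ) (M : ℕ) (N : ℝ) (u : ℝ → ℕ → ℝ) (g : ℝ → ℝ)
    (hu : ∀ a ≤ N, a ∉ A → ∀ j, u a j = 0) (hg : ∀ b, N < b → g b = 0) :
    ∑ᶠ b : ℝ, g b * ∑ j ∈ Finset.range M, u (b - j) j
      = ∑ a ∈ A, ∑ j ∈ Finset.range M, g (a + j) * u a j := by
  have key : ∀ b : ℝ, g b * ∑ j ∈ Finset.range M, u (b - j) j
      = ∑ z ∈ A ×ˢ Finset.range M, if b = z.1 + z.2 then g b * u z.1 z.2 else 0 := by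
    intro b
    by_cases hb : N < b
    · simp [hg b hb]
    push Not at hb
    rw [Finset.sum_product_right, Finset.mul_sum]
    refine Finset.sum_congr rfl fun j _ => ?_
    have h1 : ∀ a : ℝ, (b = a + j) ↔ (b - j = a) := fun a => by
      constructor <;> intro h <;> linarith
    simp only [h1]
    rw [Finset.sum_ite_eq]
    split_ifs with h
    · rfl
    · rw [hu _ _ h, mul_zero]
      have : (0:ℝ) ≤ j := Nat.cast_nonneg j
      linarith
  simp_rw [key]
  rw [finsum_sum_comm]
  · rw [Finset.sum_product]
    refine Finset.sum_congr rfl fun a _ => Finset.sum_congr rfl fun j _ => ?_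
    rw [finsum_eq_single _ (a + j)]
    · simp
    · intro x hx; simp [hx]
  · intro z _
    refine (Set.finite_singleton (z.1 + (z.2:ℝ))).subset ?_
    intro b hb
    by_contra hne
    simp at hne
    simp [hne] at hb

/-- Homogeneous Taylor term of order `j` of `φ` at `y`. -/
def tay (y : E3) (φ : E3 → ℝ) (j : ℕ) (v : E3) : ℝ :=
  ((Nat.factorial j : ℕ) : ℝ)⁻¹ * iteratedFDeriv ℝ j φ y (fun _ => v)

lemma tay_smul (y : E3) (φ : E3 → ℝ) (j : ℕ) (r : ℝ) (v : E3) :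
    tay y φ j (r • v) = r ^ j * tay y φ j v := by
  unfold tay
  have := (iteratedFDeriv ℝ j φ y).map_smul_univ (fun _ => r) (fun _ => v)
  simp only [Finset.prod_const, Finset.card_univ, Fintype.card_fin, smul_eq_mul] at this
  rw [this]; ring

lemma tay_bound (y : E3) (φ : E3 → ℝ) (j : ℕ) (B : ℝ) (hB : ‖iteratedFDeriv ℝ j φ y‖ ≤ B)
    (n : E3) (hn : ‖n‖ = 1) : |tay y φ j n| ≤ B := by
  unfold tay
  have h1 := (iteratedFDeriv ℝ j φ y).le_opNorm (fun _ => n)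
  simp only [hn, Finset.prod_const_one, mul_one] at h1
  rw [abs_mul, abs_inv, Nat.abs_cast]
  have h2 : ((Nat.factorial j : ℕ) : ℝ)⁻¹ ≤ 1 := inv_le_one_of_one_le₀ (by
    exact_mod_cast Nat.succ_le_of_lt (Nat.factorial_pos j))
  calc _ ≤ 1 * ‖iteratedFDeriv ℝ j φ y‖ := by
        apply mul_le_mul h2 h1 (abs_nonneg _) zero_le_one
    _ ≤ B := by simpa using hB

lemma tay_continuous (y : E3) (φ : E3 → ℝ) (j : ℕ) : ContDiff ℝ (⊤ : ℕ∞) (tay y φ j) := by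
  unfold tay
  apply contDiff_const.mul
  exact (iteratedFDeriv ℝ j φ y).contDiff.comp (contDiff_pi.2 fun _ => contDiff_id)

lemma iteratedDeriv_line (φ : E3 → ℝ) (hφ : ContDiff ℝ (⊤ : ℕ∞) φ) (y v : E3) (j : ℕ) (t : ℝ) :
    iteratedDeriv j (fun t : ℝ => φ (y + t • v)) t
      = iteratedFDeriv ℝ j φ (y + t • v) (fun _ => v) := by
  induction j generalizing t with
  | zero => simp
  | succ j ih =>
    rw [iteratedDeriv_succ]
    have : iteratedDeriv j (fun t : ℝ => φ (y + t • v)) =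
      fun t => iteratedFDeriv ℝ j φ (y + t • v) (fun _ => v) := funext ih
    rw [this]
    have hd : DifferentiableAt ℝ (iteratedFDeriv ℝ j φ) (y + t • v) :=
      (hφ.differentiable_iteratedFDeriv (by exact_mod_cast WithTop.coe_lt_top j)) _
    have hl : HasDerivAt (fun t : ℝ => y + t • v) v t := by
      simpa using ((hasDerivAt_id t).smul_const v).const_add y
    have h1 := hd.hasFDerivAt.comp_hasDerivAt t hl
    have h2 := ((ContinuousMultilinearMap.apply ℝ (fun _ : Fin j => E3) ℝ
      (fun _ => v)).hasFDerivAt).comp_hasDerivAt t h1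
    have h3 := h2.deriv
    rw [iteratedFDeriv_succ_apply_left]
    exact h3

lemma taylor_line (φ : E3 → ℝ) (hφ : ContDiff ℝ (⊤ : ℕ∞) φ) (y v : E3) (M : ℕ) (B : ℝ)
    (hB : ∀ x, ‖iteratedFDeriv ℝ (M + 1) φ x‖ ≤ B) :
    |φ (y + v) - ∑ j ∈ Finset.range (M + 1), tay y φ j v| ≤ B * ‖v‖ ^ (M + 1) := by
  set g : ℝ → ℝ := fun t => φ (y + t • v) with hg
  have hgs : ContDiff ℝ (⊤ : ℕ∞) g := by
    apply hφ.comp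
    exact contDiff_const.add (contDiff_id.smul contDiff_const)
  have hgM : ContDiff ℝ ((M + 1 : ℕ) : WithTop ℕ∞) g := hgs.of_le (by exact_mod_cast le_top)
  have hu := uniqueDiffOn_Icc (zero_lt_one (α := ℝ))
  have hw : ∀ j ≤ M + 1, ∀ t ∈ Set.Icc (0:ℝ) 1,
      iteratedDerivWithin j g (Set.Icc 0 1) t = iteratedFDeriv ℝ j φ (y + t • v) (fun _ => v) := by
    intro j hj t ht
    rw [iteratedDerivWithin_eq_iteratedDeriv hu _ ht, iteratedDeriv_line φ hφ]
    exact (hgM.of_le (by exact_mod_cast hj)).contDiffAt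
  have := taylor_mean_remainder_bound (f := g) (a := 0) (b := 1) (x := 1) (n := M)
    (C := B * ‖v‖ ^ (M + 1)) zero_le_one (by exact_mod_cast hgM.contDiffOn) (by simp) (by
      intro t ht
      rw [hw _ le_rfl t ht]
      have h1 := (iteratedFDeriv ℝ (M + 1) φ (y + t • v)).le_opNorm (fun _ => v)
      simp only [Finset.prod_const, Finset.card_univ, Fintype.card_fin] at h1
      exact h1.trans (by gcongr; exact hB _))
  rw [taylor_within_apply] at this
  have he : ∑ k ∈ Finset.range (M + 1), ((Nat.factorial k : ℝ)⁻¹ * (1 - 0) ^ k) •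
      iteratedDerivWithin k g (Set.Icc 0 1) 0 = ∑ j ∈ Finset.range (M + 1), tay y φ j v := by
    refine Finset.sum_congr rfl fun k hk => ?_
    rw [hw k (Finset.mem_range.1 hk).le 0 (by simp)]
    simp [tay]
  rw [he] at this
  have hB0 : 0 ≤ B := (norm_nonneg _).trans (hB 0)
  have hf : (1:ℝ) ≤ (Nat.factorial M : ℕ) := by
    exact_mod_cast Nat.succ_le_of_lt (Nat.factorial_pos M)
  simp only [hg, one_smul, Real.norm_eq_abs, sub_zero, one_pow, mul_one] at this
  exact this.trans (div_le_self (by positivity) hf)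

lemma SmoothSphereFn.bound {f : S2 → ℝ} (hf : SmoothSphereFn f) : ∃ C, 0 ≤ C ∧ ∀ n, |f n| ≤ C := by
  obtain ⟨g, hg, hgf⟩ := hf
  obtain ⟨C, hC⟩ := (isCompact_sphere (0:E3) 1).exists_bound_of_continuousOn
    hg.continuous.continuousOn
  refine ⟨max C 0, le_max_right _ _, fun n => ?_⟩
  rw [← hgf n]
  exact (hC n n.2).trans (le_max_left _ _)

lemma finsum_le_eq (A : Finset ℝ) (N : ℝ) (hA : ∀ a ∈ A, a ≤ N) (f : ℝ → ℝ)
    (hf : ∀ a ≤ N, a ∉ A → f a = 0) :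
    ∑ᶠ (a : ℝ) (_ : a ≤ N), f a = ∑ a ∈ A, f a := by
  classical
  rw [finsum_eq_sum_of_support_subset (s := A)]
  · refine Finset.sum_congr rfl fun a ha => ?_
    rw [finsum_eq_if, if_pos (hA a ha)]
  · intro a ha
    rw [Function.mem_support, finsum_eq_if] at ha
    by_contra hn
    apply ha
    split_ifs with h
    · exact hf a h hn
    · rfl

lemma core {y : E3} {F : E3 → ℝ} {c : ℝ → S2 → ℝ} (h : HasSingExpansion y F c) (N : ℕ) :
    ∃ (A : Finset ℝ) (M : ℕ), (∀ a ≤ (N:ℝ), a ∉ A → c a = 0) ∧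
      (∀ b ≤ (N:ℝ), ∀ j : ℕ, M ≤ j → c (b - j) = 0) ∧
      ∀ ε > 0, ∃ δ > 0, ∀ (φ : E3 → ℝ) (B : ℝ), ContDiff ℝ (⊤ : ℕ∞) φ →
        (∀ j ≤ M, ∀ x, ‖iteratedFDeriv ℝ j φ x‖ ≤ B) → ∀ r : ℝ, 0 < r → r < δ → ∀ n : S2,
        |F (y + r • (n : E3)) * φ (y + r • (n : E3))
          - ∑ a ∈ A, ∑ j ∈ Finset.range M, r ^ (a + j) * (c a n * tay y φ j n)|
        ≤ ε * B * r ^ (N:ℝ) := by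
  obtain ⟨a₁, ha₁⟩ := h.bddBelow
  set a₀ := min a₁ 0 with ha₀
  have ha₀1 : a₀ ≤ a₁ := min_le_left _ _
  have ha₀0 : a₀ ≤ 0 := min_le_right _ _
  set m := ⌈(N:ℝ) + 1 - a₀⌉₊ with hm
  have hmle : (N:ℝ) + 1 - a₀ ≤ m := Nat.le_ceil _
  set A := (h.finite_exponents N).toFinset with hA
  have hAmem : ∀ a, a ∈ A ↔ (a ≤ (N:ℝ) ∧ c a ≠ 0) := by intro a; simp [hA]
  have hA0 : ∀ a ≤ (N:ℝ), a ∉ A → c a = 0 := by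
    intro a ha hn
    by_contra hc
    exact hn ((hAmem a).2 ⟨ha, hc⟩)
  refine ⟨A, m + 1, hA0, ?_, ?_⟩
  · intro b hb j hj
    apply ha₁
    have : ((m + 1 : ℕ) : ℝ) ≤ j := by exact_mod_cast hj
    push_cast at this
    linarith
  choose Cc hc0 hc using fun a => (h.smooth_coeffs a).bound
  set C : ℝ := ∑ a ∈ A, Cc a + 1 with hC
  have hCpos : 0 < C := by
    have : 0 ≤ ∑ a ∈ A, Cc a := Finset.sum_nonneg fun a _ => hc0 a
    linarith
  intro ε hε
  set ε' := min 1 (ε / (2 * (m + 1))) with hε'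
  have hε'pos : 0 < ε' := lt_min one_pos (by positivity)
  obtain ⟨δ₁, hδ₁, hexp⟩ := h.expansion N ε' hε'pos
  refine ⟨min (min δ₁ 1) (ε / (2 * C)), lt_min (lt_min hδ₁ one_pos) (by positivity), ?_⟩
  intro φ B hφ hB r hr0 hrδ n
  have hr1 : r < δ₁ := hrδ.trans_le ((min_le_left _ _).trans (min_le_left _ _))
  have hr2 : r < 1 := hrδ.trans_le ((min_le_left _ _).trans (min_le_right _ _))
  have hr3 : r < ε / (2 * C) := hrδ.trans_le (min_le_right _ _)
  have hn1 : ‖(n:E3)‖ = 1 := by simpa using n.2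
  have hB0 : 0 ≤ B := (norm_nonneg _).trans (hB 0 (Nat.zero_le _) 0)
  have hG := hexp r hr0 hr1 n
  rw [finsum_le_eq A N (fun a ha => ((hAmem a).1 ha).1) (fun a => r ^ a * c a n) (by
    intro a ha hn; simp [hA0 a ha hn])] at hG
  set x := y + r • (n:E3) with hx
  set S := ∑ a ∈ A, r ^ a * c a n with hS
  set P := ∑ j ∈ Finset.range (m + 1), r ^ j * tay y φ j n with hP
  have hrN : 0 < r ^ (N:ℝ) := Real.rpow_pos_of_pos hr0 _
  have hSb : |S| ≤ (∑ a ∈ A, Cc a) * r ^ a₀ := by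
    rw [hS, Finset.sum_mul]
    refine (Finset.abs_sum_le_sum_abs _ _).trans (Finset.sum_le_sum fun a ha => ?_)
    rw [abs_mul, abs_of_pos (Real.rpow_pos_of_pos hr0 _), mul_comm]
    have haa : a₀ ≤ a := by
      by_contra hlt
      push Not at hlt
      exact ((hAmem a).1 ha).2 (ha₁ a (hlt.trans_le ha₀1))
    have := Real.rpow_le_rpow_of_exponent_ge hr0 hr2.le haa
    exact mul_le_mul (hc a n) this (Real.rpow_pos_of_pos hr0 _).le (hc0 a)
  have hFb : |F x| ≤ C * r ^ a₀ := by
    have h1 : ε' * r ^ (N:ℝ) ≤ 1 * r ^ a₀ := by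
      apply mul_le_mul (min_le_left _ _) _ hrN.le zero_le_one
      exact Real.rpow_le_rpow_of_exponent_ge hr0 hr2.le (ha₀0.trans (Nat.cast_nonneg N))
    have h2 : |F x| ≤ |F x - S| + |S| := by
      have := abs_add_le (F x - S) S
      simpa using this
    rw [hC, add_mul]
    linarith
  have hrem : |φ x - P| ≤ B * r ^ (m + 1) := by
    have := taylor_line φ hφ y (r • (n:E3)) m B (hB (m + 1) le_rfl)
    rw [norm_smul, hn1, mul_one, Real.norm_eq_abs, abs_of_pos hr0] at this
    simpa only [tay_smul] using this
  have hPb : |P| ≤ (m + 1) * B := by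
    refine (Finset.abs_sum_le_sum_abs _ _).trans ?_
    have : ∀ j ∈ Finset.range (m + 1), |r ^ j * tay y φ j n| ≤ B := by
      intro j hj
      rw [abs_mul, abs_of_pos (pow_pos hr0 _)]
      have h1 := tay_bound y φ j B (hB j (Finset.mem_range.1 hj).le y) n hn1
      have h2 : r ^ j ≤ 1 := pow_le_one₀ hr0.le hr2.le
      calc _ ≤ 1 * B := mul_le_mul h2 h1 (abs_nonneg _) zero_le_one
        _ = B := one_mul B
    simpa using Finset.sum_le_sum this
  have hsplit : F x * φ x - ∑ a ∈ A, ∑ j ∈ Finset.range (m + 1),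
      r ^ (a + j) * (c a n * tay y φ j n) = F x * (φ x - P) + (F x - S) * P := by
    have : ∑ a ∈ A, ∑ j ∈ Finset.range (m + 1),
      r ^ (a + j) * (c a n * tay y φ j n) = S * P := by
      rw [hS, hP, Finset.sum_mul_sum]
      refine Finset.sum_congr rfl fun a _ => Finset.sum_congr rfl fun j _ => ?_
      rw [Real.rpow_add hr0, Real.rpow_natCast]; ring
    rw [this]; ring
  rw [hsplit]
  have hp1 : r ^ a₀ * r ^ (m + 1) ≤ r * r ^ (N:ℝ) := by
    rw [← Real.rpow_natCast r (m + 1), ← Real.rpow_add hr0]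
    have : r * r ^ (N:ℝ) = r ^ ((N:ℝ) + 1) := by
      rw [Real.rpow_add hr0, Real.rpow_one]; ring
    rw [this]
    apply Real.rpow_le_rpow_of_exponent_ge hr0 hr2.le
    push_cast
    linarith
  have t1 : |F x * (φ x - P)| ≤ ε / 2 * B * r ^ (N:ℝ) := by
    rw [abs_mul]
    calc |F x| * |φ x - P| ≤ (C * r ^ a₀) * (B * r ^ (m + 1)) := by gcongr
      _ = C * B * (r ^ a₀ * r ^ (m + 1)) := by ring
      _ ≤ C * B * (r * r ^ (N:ℝ)) := by gcongr
      _ ≤ C * B * (ε / (2 * C) * r ^ (N:ℝ)) := by gcongr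
      _ = _ := by field_simp
  have t2 : |(F x - S) * P| ≤ ε / 2 * B * r ^ (N:ℝ) := by
    rw [abs_mul]
    calc |F x - S| * |P| ≤ (ε' * r ^ (N:ℝ)) * ((m + 1) * B) := by gcongr
      _ ≤ (ε / (2 * (m + 1)) * r ^ (N:ℝ)) * ((m + 1) * B) := by
        gcongr; exact min_le_right _ _
      _ = _ := by field_simp
  calc _ ≤ _ := abs_add_le _ _
    _ ≤ ε / 2 * B * r ^ (N:ℝ) + ε / 2 * B * r ^ (N:ℝ) := add_le_add t1 t2
    _ = _ := by ring

lemma SmoothSphereFn.mul_tay {f : S2 → ℝ} (hf : SmoothSphereFn f) (y : E3) (φ : E3 → ℝ) (j : ℕ) :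
    SmoothSphereFn (fun n => f n * tay y φ j n) := by
  obtain ⟨g, hg, hgf⟩ := hf
  exact ⟨fun x => g x * tay y φ j x, hg.mul (tay_continuous y φ j), fun n => by simp [hgf]⟩

lemma SmoothSphereFn.sum {ι : Type*} (s : Finset ι) (f : ι → S2 → ℝ)
    (hf : ∀ i, SmoothSphereFn (f i)) : SmoothSphereFn (fun n => ∑ i ∈ s, f i n) := by
  choose g hg hgf using hf
  exact ⟨fun x => ∑ i ∈ s, g i x, ContDiff.sum fun i _ => hg i, fun n => by simp [hgf]⟩

lemma SmoothSphereFn.integrable {f : S2 → ℝ} (hf : SmoothSphereFn f) : Integrable f dOmega := by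
  obtain ⟨g, hg, hgf⟩ := hf
  have : f = fun n : S2 => g n := funext fun n => (hgf n).symm
  rw [this]
  have hc : Continuous fun n : S2 => g n := hg.continuous.comp continuous_subtype_val
  exact hc.integrable_of_hasCompactSupport (HasCompactSupport.of_compactSpace _)

/-- Coefficients of the expansion of the product `F φ`. -/
def prodCoeff (y : E3) (c : ℝ → S2 → ℝ) (φ : E3 → ℝ) (b : ℝ) (n : S2) : ℝ :=
  ∑ᶠ j : ℕ, c (b - j) n * tay y φ j n

lemma prodCoeff_eq (y : E3) (c : ℝ → S2 → ℝ) (φ : E3 → ℝ) (b : ℝ) (M : ℕ)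
    (hM : ∀ j : ℕ, M ≤ j → c (b - j) = 0) :
    prodCoeff y c φ b = fun n => ∑ j ∈ Finset.range M, c (b - j) n * tay y φ j n := by
  ext n
  unfold prodCoeff
  apply finsum_eq_sum_of_support_subset
  intro j hj
  simp only [Finset.coe_range, Set.mem_Iio]
  by_contra hn
  push Not at hn
  simp [hM j hn] at hj

lemma exists_bound_iter (φ : E3 → ℝ) (hφ : ContDiff ℝ (⊤ : ℕ∞) φ) (hc : HasCompactSupport φ)
    (M : ℕ) : ∃ B, ∀ j ≤ M, ∀ x, ‖iteratedFDeriv ℝ j φ x‖ ≤ B := by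
  have : ∀ j : ℕ, ∃ B, ∀ x, ‖iteratedFDeriv ℝ j φ x‖ ≤ B := fun j =>
    (hc.iteratedFDeriv j).exists_bound_of_continuous
      (hφ.continuous_iteratedFDeriv (by exact_mod_cast le_top))
  choose B hB using this
  refine ⟨∑ j ∈ Finset.range (M + 1), B j, fun j hj x => (hB j x).trans ?_⟩
  exact Finset.single_le_sum (f := B) (fun i _ => (norm_nonneg _).trans (hB i 0))
    (Finset.mem_range.2 (Nat.lt_succ_of_le hj))

lemma sing_mul {y : E3} {F : E3 → ℝ} {c : ℝ → S2 → ℝ} (h : HasSingExpansion y F c)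
    (φ : E3 → ℝ) (hφ : ContDiff ℝ (⊤ : ℕ∞) φ) (hc : HasCompactSupport φ) :
    HasSingExpansion y (fun x => F x * φ x) (prodCoeff y c φ) := by
  classical
  have hdat : ∀ N : ℝ, ∃ (A : Finset ℝ) (M : ℕ), (∀ a ≤ N, a ∉ A → c a = 0) ∧
      (∀ b ≤ N, ∀ j : ℕ, M ≤ j → c (b - j) = 0) := by
    intro N
    obtain ⟨A, M, h1, h2, -⟩ := core h ⌈N⌉₊
    exact ⟨A, M, fun a ha => h1 a (ha.trans (Nat.le_ceil N)),
      fun b hb => h2 b (hb.trans (Nat.le_ceil N))⟩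
  refine ⟨?_, ?_, ?_, ?_⟩
  · intro b
    obtain ⟨A, M, -, h2⟩ := hdat b
    rw [prodCoeff_eq y c φ b M (h2 b le_rfl)]
    exact SmoothSphereFn.sum _ _ fun j => (h.smooth_coeffs _).mul_tay y φ j
  · obtain ⟨a₀, ha₀⟩ := h.bddBelow
    refine ⟨a₀, fun a ha => ?_⟩
    rw [prodCoeff_eq y c φ a 0]
    · ext n; simp
    · intro j _
      apply ha₀
      have : (0:ℝ) ≤ j := Nat.cast_nonneg j
      linarith
  · intro N
    obtain ⟨A, M, h1, h2⟩ := hdat N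
    refine ((A ×ˢ Finset.range M).image (fun z => z.1 + (z.2:ℝ))).finite_toSet.subset ?_
    rintro b ⟨hb, hne⟩
    by_contra hnot
    apply hne
    rw [prodCoeff_eq y c φ b M (h2 b hb)]
    ext n
    apply Finset.sum_eq_zero
    intro j hj
    have : c (b - j) = 0 := by
      apply h1
      · have : (0:ℝ) ≤ j := Nat.cast_nonneg j
        linarith
      · intro hmem
        apply hnot
        simp only [Finset.coe_image, Set.mem_image]
        exact ⟨(b - j, j), by simpa using ⟨hmem, by simpa using hj⟩, by simp⟩
    simp [this]
  · intro N ε hε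
    obtain ⟨A, M, h1, h2, h3⟩ := core h N
    obtain ⟨B, hB⟩ := exists_bound_iter φ hφ hc M
    have hB0 : 0 ≤ B := (norm_nonneg _).trans (hB 0 (Nat.zero_le _) 0)
    obtain ⟨δ₁, hδ₁, hcore⟩ := h3 (ε / (2 * (B + 1))) (by positivity)
    choose Cc hc0 hcb using fun a => (h.smooth_coeffs a).bound
    -- the finitely many superfluous terms
    set z : ℝ → ℝ := fun r => ∑ a ∈ A, ∑ j ∈ Finset.range M,
      if (N:ℝ) < a + j then Cc a * B * r ^ (a + j - N) else 0 with hz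
    have hzt : Tendsto z (𝓝[>] 0) (𝓝 0) := by
      have : (0:ℝ) = ∑ a ∈ A, ∑ j ∈ Finset.range M, (0:ℝ) := by simp
      rw [this, hz]
      refine tendsto_finsetSum _ fun a _ => tendsto_finsetSum _ fun j _ => ?_
      split_ifs with hlt
      · have hp : 0 < a + j - N := by linarith
        have := (Real.continuousAt_rpow_const 0 (a + j - N) (Or.inr hp.le)).tendsto
        rw [Real.zero_rpow hp.ne'] at this
        have := (this.const_mul (Cc a * B)).mono_left (nhdsWithin_le_nhds (s := Set.Ioi 0))
        simpa using this
      · exact tendsto_const_nhds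
    have hev : ∀ᶠ r in 𝓝[>] (0:ℝ), z r < ε / 2 := hzt.eventually (gt_mem_nhds (by positivity))
    rw [eventually_nhdsWithin_iff, Metric.eventually_nhds_iff] at hev
    obtain ⟨δ₂, hδ₂, hev⟩ := hev
    refine ⟨min δ₁ δ₂, lt_min hδ₁ hδ₂, ?_⟩
    intro r hr0 hr n
    have hn1 : ‖(n:E3)‖ = 1 := by simpa using n.2
    have hrN : 0 < r ^ (N:ℝ) := Real.rpow_pos_of_pos hr0 _
    have k1 := hcore φ B hφ hB r hr0 (hr.trans_le (min_le_left _ _)) n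
    have k2 : z r < ε / 2 := hev (by
      rw [Real.dist_eq, sub_zero, abs_of_pos hr0]; exact hr.trans_le (min_le_right _ _)) hr0
    have hsum : ∑ᶠ (b : ℝ) (_ : b ≤ (N:ℝ)), r ^ b * prodCoeff y c φ b n
        = ∑ a ∈ A, ∑ j ∈ Finset.range M,
          (if a + j ≤ (N:ℝ) then r ^ (a + j) else 0) * (c a n * tay y φ j n) := by
      rw [← reindex A M N (fun a j => c a n * tay y φ j n)
        (fun b => if b ≤ (N:ℝ) then r ^ b else 0)]
      · refine finsum_congr fun b => ?_
        rw [finsum_eq_if]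
        split_ifs with hb
        · rw [prodCoeff_eq y c φ b M (h2 b hb)]
        · simp
      · intro a ha hn j
        simp [h1 a ha hn]
      · intro b hb
        simp [not_le.2 hb]
    have k3 : |∑ a ∈ A, ∑ j ∈ Finset.range M, r ^ (a + j) * (c a n * tay y φ j n)
        - ∑ᶠ (b : ℝ) (_ : b ≤ (N:ℝ)), r ^ b * prodCoeff y c φ b n| ≤ z r * r ^ (N:ℝ) := by
      rw [hsum, ← Finset.sum_sub_distrib, hz, Finset.sum_mul]
      refine (Finset.abs_sum_le_sum_abs _ _).trans (Finset.sum_le_sum fun a _ => ?_)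
      rw [← Finset.sum_sub_distrib, Finset.sum_mul]
      refine (Finset.abs_sum_le_sum_abs _ _).trans (Finset.sum_le_sum fun j hj => ?_)
      by_cases hle : a + j ≤ (N:ℝ)
      · simp [hle, not_lt.2 hle]
      · rw [if_neg hle, if_pos (not_le.1 hle), zero_mul, sub_zero, abs_mul, abs_mul,
          abs_of_pos (Real.rpow_pos_of_pos hr0 _)]
        have hr' : r ^ (a + j) = r ^ (a + j - N) * r ^ (N:ℝ) := by
          rw [← Real.rpow_add hr0]; ring_nf
        rw [hr']
        have b1 := hcb a n
        have b2 := tay_bound y φ j B (hB j (Finset.mem_range.1 hj).le y) n hn1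
        have b3 : |c a n| * |tay y φ j n| ≤ Cc a * B :=
          mul_le_mul b1 b2 (abs_nonneg _) (hc0 a)
        have b4 : 0 < r ^ (a + j - N) := Real.rpow_pos_of_pos hr0 _
        calc _ ≤ r ^ (a + j - N) * r ^ (N:ℝ) * (Cc a * B) := by gcongr
          _ = _ := by ring
    have k4 : ε / (2 * (B + 1)) * B ≤ ε / 2 := by
      rw [div_mul_eq_mul_div, div_le_div_iff₀ (by positivity) (by positivity)]
      nlinarith
    refine (abs_sub_le _ _ _).trans ((add_le_add k1 k3).trans ?_)
    nlinarith

lemma tay_add (y : E3) (φ ψ : E3 → ℝ) (hφ : ContDiff ℝ (⊤ : ℕ∞) φ) (hψ : ContDiff ℝ (⊤ : ℕ∞) ψ)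
    (j : ℕ) (v : E3) : tay y (φ + ψ) j v = tay y φ j v + tay y ψ j v := by
  unfold tay
  rw [iteratedFDeriv_add_apply (hφ.of_le (by exact_mod_cast le_top)).contDiffAt
    (hψ.of_le (by exact_mod_cast le_top)).contDiffAt]
  simp [mul_add]

lemma tay_const_smul (y : E3) (r : ℝ) (φ : E3 → ℝ) (hφ : ContDiff ℝ (⊤ : ℕ∞) φ)
    (j : ℕ) (v : E3) : tay y (r • φ) j v = r * tay y φ j v := by
  unfold tay
  rw [iteratedFDeriv_const_smul_apply (hφ.of_le (by exact_mod_cast le_top)).contDiffAt]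
  simp; ring

/-- The unit direction from `y` to `x`. -/
def dir (y x : E3) : E3 := ‖x - y‖⁻¹ • (x - y)

lemma dir_cont (y : E3) : ContinuousOn (dir y) {y}ᶜ := by
  unfold dir
  refine ContinuousOn.smul (f := fun x => ‖x - y‖⁻¹) (g := fun x => x - y) ?_ ?_
  · apply ContinuousOn.inv₀ (by fun_prop)
    intro x hx
    simpa [sub_eq_zero] using hx
  · fun_prop

lemma term_cont (y : E3) (b : ℝ) (f : E3 → ℝ) (hf : Continuous f) :
    ContinuousOn (fun x => ‖x - y‖ ^ b * f (dir y x)) {y}ᶜ := by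
  apply ContinuousOn.mul
  · apply ContinuousOn.rpow_const (by fun_prop)
    intro x hx
    left
    simpa [sub_eq_zero] using hx
  · exact hf.comp_continuousOn (dir_cont y)

lemma ann_integrable (y : E3) (s R : ℝ) (hs : 0 < s) (f : E3 → ℝ)
    (hf : ContinuousOn f {y}ᶜ) :
    IntegrableOn f (Metric.ball y R \ Metric.closedBall y s) := by
  have hK : IsCompact (Metric.closedBall y R \ Metric.ball y s) :=
    (isCompact_closedBall y R).diff Metric.isOpen_ball
  have : IntegrableOn f (Metric.closedBall y R \ Metric.ball y s) := by
    refine ContinuousOn.integrableOn_compact (hK := hK) ?_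
    apply hf.mono
    rintro x ⟨-, hx⟩ rfl
    exact hx (Metric.mem_ball_self hs)
  exact this.mono_set (Set.sdiff_subset_sdiff Metric.ball_subset_closedBall
    Metric.ball_subset_closedBall)

/-- limiting weights -/
def wgt (R s₁ b : ℝ) : ℝ := if b = -3 then Real.log (R / s₁) else R ^ (b + 3) / (b + 3)

lemma wgt_tendsto (R s₁ b : ℝ) (hR : 0 < R) (hs₁ : 0 < s₁) :
    Tendsto (fun s => (∫ r in s..R, r ^ (b + 2)) + (if b < -3 then s ^ (b + 3) / (b + 3) else 0)
      + Real.log (s / s₁) * (if b = -3 then 1 else 0)) (𝓝[>] 0) (𝓝 (wgt R s₁ b)) := by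
  have hev : ∀ᶠ s in 𝓝[>] (0:ℝ), 0 < s ∧ s < R := by
    filter_upwards [Ioo_mem_nhdsGT hR] with s hs using hs
  rcases lt_trichotomy b (-3) with hb | hb | hb
  · apply tendsto_const_nhds.congr'
    filter_upwards [hev] with s hs
    rw [radial_integral b s R hs.1 hs.2, wgt, if_neg hb.ne, if_neg hb.ne, if_pos hb, if_neg hb.ne]
    ring
  · apply tendsto_const_nhds.congr'
    filter_upwards [hev] with s hs
    rw [radial_integral b s R hs.1 hs.2, wgt, if_pos hb, if_pos hb, if_neg (by linarith), if_pos hb]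
    rw [Real.log_div hR.ne' hs.1.ne', Real.log_div hs.1.ne' hs₁.ne', Real.log_div hR.ne' hs₁.ne']
    ring
  · have hp : 0 < b + 3 := by linarith
    have h1 := (Real.continuousAt_rpow_const 0 (b + 3) (Or.inr hp.le)).tendsto
    rw [Real.zero_rpow hp.ne'] at h1
    have h2 := ((h1.mono_left (nhdsWithin_le_nhds (s := Set.Ioi 0))).const_sub
      (R ^ (b + 3))).div_const (b + 3)
    rw [sub_zero] at h2
    have : wgt R s₁ b = R ^ (b + 3) / (b + 3) := by rw [wgt, if_neg hb.ne']
    rw [this]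
    apply h2.congr'
    filter_upwards [hev] with s hs
    rw [radial_integral b s R hs.1 hs.2, if_neg hb.ne', if_neg (by linarith), if_neg hb.ne']
    ring

lemma near_exists {y : E3} {F : E3 → ℝ} {c : ℝ → S2 → ℝ} (h : HasSingExpansion y F c)
    (s₁ : ℝ) (hs₁ : 0 < s₁) :
    ∃ R₀ > 0, ∀ R, 0 < R → R < R₀ → ContinuousOn F (Metric.closedBall y R \ {y}) →
      ∃ (T : (E3 → ℝ) → ℝ) (M : ℕ) (C : ℝ),
      (∀ φ : E3 → ℝ, ContDiff ℝ (⊤ : ℕ∞) φ → HasCompactSupport φ →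
        Tendsto (fun s => (∫ x in Metric.ball y R \ Metric.closedBall y s, F x * φ x)
          + (∑ᶠ (a : ℝ) (_ : a < -3), s ^ (a + 3) / (a + 3) * ∫ n : S2, prodCoeff y c φ a n ∂dOmega)
          + Real.log (s / s₁) * (∫ n : S2, prodCoeff y c φ (-3) n ∂dOmega)) (𝓝[>] 0) (𝓝 (T φ)))
      ∧ (∀ φ ψ : E3 → ℝ, ContDiff ℝ (⊤ : ℕ∞) φ → HasCompactSupport φ →
          ContDiff ℝ (⊤ : ℕ∞) ψ → HasCompactSupport ψ → T (φ + ψ) = T φ + T ψ)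
      ∧ (∀ (r : ℝ) (φ : E3 → ℝ), ContDiff ℝ (⊤ : ℕ∞) φ → HasCompactSupport φ →
          T (r • φ) = r * T φ)
      ∧ (∀ (φ : E3 → ℝ) (B : ℝ), ContDiff ℝ (⊤ : ℕ∞) φ →
          (∀ j ≤ M, ∀ x, ‖iteratedFDeriv ℝ j φ x‖ ≤ B) → |T φ| ≤ C * B) := by
  obtain ⟨A, M, h1, h2, h3⟩ := core h 0
  simp only [Nat.cast_zero, Real.rpow_zero, mul_one] at h1 h2 h3
  obtain ⟨δ, hδ, hcore⟩ := h3 1 one_pos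
  refine ⟨δ, hδ, fun R hR hRδ hFc => ?_⟩
  choose g hgs hgc using h.smooth_coeffs
  choose Cc hc0 hcb using fun a => (h.smooth_coeffs a).bound
  set Bp : Set E3 := Metric.ball y R \ {y} with hBp
  have hBpm : MeasurableSet Bp := measurableSet_ball.diff (measurableSet_singleton y)
  have hBpy : Bp ⊆ {y}ᶜ := fun x hx => hx.2
  have hBpc : Bp ⊆ Metric.closedBall y R \ {y} :=
    Set.sdiff_subset_sdiff_left Metric.ball_subset_closedBall
  have hBpfin : volume Bp < ⊤ := (measure_mono Set.sdiff_subset).trans_lt measure_ball_lt_top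
  let tm : (E3 → ℝ) → ℝ → ℕ → E3 → ℝ := fun φ a j x =>
    ‖x - y‖ ^ (a + j) * (g a (dir y x) * tay y φ j (dir y x))
  let D : (E3 → ℝ) → E3 → ℝ := fun φ x => ∑ a ∈ A, ∑ j ∈ Finset.range M, tm φ a j x
  let H : (E3 → ℝ) → E3 → ℝ := fun φ x => F x * φ x - D φ x
  let I : (E3 → ℝ) → ℝ → ℕ → ℝ := fun φ a j => ∫ n : S2, c a n * tay y φ j n ∂dOmega
  let T : (E3 → ℝ) → ℝ := fun φ => (∫ x in Bp, H φ x)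
    + ∑ a ∈ A, ∑ j ∈ Finset.range M, wgt R s₁ (a + j) * I φ a j
  have htmc : ∀ φ a j, ContinuousOn (tm φ a j) {y}ᶜ := fun φ a j =>
    term_cont y (a + j) (fun v => g a v * tay y φ j v)
      ((hgs a).continuous.mul (tay_continuous y φ j).continuous)
  have hDc : ∀ φ, ContinuousOn (D φ) {y}ᶜ := fun φ =>
    continuousOn_finsetSum _ fun a _ => continuousOn_finsetSum _ fun j _ => htmc φ a j
  have hHc : ∀ φ, ContDiff ℝ (⊤ : ℕ∞) φ → ContinuousOn (H φ) Bp := fun φ hφ =>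
    ((hFc.mono hBpc).mul hφ.continuous.continuousOn).sub ((hDc φ).mono hBpy)
  have hHb : ∀ φ B, ContDiff ℝ (⊤ : ℕ∞) φ →
      (∀ j ≤ M, ∀ x, ‖iteratedFDeriv ℝ j φ x‖ ≤ B) → ∀ x ∈ Bp, ‖H φ x‖ ≤ B := by
    intro φ B hφ hB x hx
    have hxy : x - y ≠ 0 := sub_ne_zero.2 hx.2
    have hr0 : 0 < ‖x - y‖ := norm_pos_iff.2 hxy
    have hrR : ‖x - y‖ < δ := lt_trans (by simpa [dist_eq_norm] using hx.1) hRδ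
    have hdn : dir y x ∈ Metric.sphere (0:E3) 1 := by
      simp [dir, norm_smul, hr0.ne']
    have := hcore φ B hφ hB ‖x - y‖ hr0 hrR ⟨dir y x, hdn⟩
    have hxx : y + ‖x - y‖ • dir y x = x := by
      simp [dir, smul_smul, hr0.ne']
    simp only [hxx, ← hgc, one_mul] at this
    exact this
  have hHi : ∀ φ, ContDiff ℝ (⊤ : ℕ∞) φ → HasCompactSupport φ → IntegrableOn (H φ) Bp := by
    intro φ hφ hφc
    obtain ⟨B, hB⟩ := exists_bound_iter φ hφ hφc M
    refine IntegrableOn.of_bound hBpfin ((hHc φ hφ).aestronglyMeasurable hBpm) B ?_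
    exact (ae_restrict_iff' hBpm).2 (Eventually.of_forall fun x hx => hHb φ B hφ hB x hx)
  have hIint : ∀ φ a j, Integrable (fun n : S2 => c a n * tay y φ j n) dOmega := fun φ a j =>
    ((h.smooth_coeffs a).mul_tay y φ j).integrable
  refine ⟨T, M, volume.real Bp + ∑ a ∈ A, ∑ j ∈ Finset.range M,
    |wgt R s₁ (a + j)| * (Cc a * dOmega.real Set.univ), ?_, ?_, ?_, ?_⟩
  · intro φ hφ hφc
    have hlim1 : Tendsto (fun s => ∫ x in Metric.ball y R \ Metric.closedBall y s, H φ x)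
        (𝓝[>] 0) (𝓝 (∫ x in Bp, H φ x)) := by
      have hcov : AECover (volume.restrict Bp) (𝓝[>] (0:ℝ))
          (fun s => (Metric.closedBall y s)ᶜ) := by
        refine ⟨?_, fun s => measurableSet_closedBall.compl⟩
        refine (ae_restrict_iff' hBpm).2 (Eventually.of_forall fun x hx => ?_)
        have hd : 0 < dist x y := dist_pos.2 hx.2
        filter_upwards [Ioo_mem_nhdsGT hd] with s hs
        simpa using hs.2
      have := hcov.integral_tendsto_of_countably_generated (hHi φ hφ hφc)
      apply this.congr'
      filter_upwards [self_mem_nhdsWithin] with s hs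
      rw [Measure.restrict_restrict measurableSet_closedBall.compl]
      congr 2
      ext x
      simp only [hBp, Set.mem_inter_iff, Set.mem_compl_iff, Set.mem_sdiff, Set.mem_singleton_iff]
      constructor
      · rintro ⟨a, b, -⟩; exact ⟨b, a⟩
      · rintro ⟨a, b⟩
        refine ⟨b, a, ?_⟩
        rintro rfl
        exact b (Metric.mem_closedBall_self (le_of_lt hs))
    have hlim2 : Tendsto (fun s => ∑ a ∈ A, ∑ j ∈ Finset.range M,
        ((∫ r in s..R, r ^ (a + j + 2))
          + (if a + j < -3 then s ^ (a + j + 3) / (a + j + 3) else 0)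
          + Real.log (s / s₁) * (if a + j = -3 then 1 else 0)) * I φ a j) (𝓝[>] 0)
        (𝓝 (∑ a ∈ A, ∑ j ∈ Finset.range M, wgt R s₁ (a + j) * I φ a j)) :=
      tendsto_finsetSum _ fun a _ => tendsto_finsetSum _ fun j _ =>
        (wgt_tendsto R s₁ (a + j) hR hs₁).mul_const _
    apply (hlim1.add hlim2).congr'
    filter_upwards [Ioo_mem_nhdsGT hR] with s hs
    have hpint : ∀ b ≤ (0:ℝ), ∫ n : S2, prodCoeff y c φ b n ∂dOmega
        = ∑ j ∈ Finset.range M, I φ (b - j) j := by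
      intro b hb
      rw [prodCoeff_eq y c φ b M (h2 b hb), integral_finsetSum _ fun j _ => hIint φ _ j]
    have hu : ∀ a ≤ (0:ℝ), a ∉ A → ∀ j, I φ a j = 0 := by
      intro a ha hn j
      simp [I, h1 a ha hn]
    have e1 : ∑ᶠ (a : ℝ) (_ : a < -3), s ^ (a + 3) / (a + 3) *
        ∫ n : S2, prodCoeff y c φ a n ∂dOmega
        = ∑ a ∈ A, ∑ j ∈ Finset.range M,
          (if a + j < -3 then s ^ (a + j + 3) / (a + j + 3) else 0) * I φ a j := by
      rw [← reindex A M 0 (I φ) (fun b => if b < -3 then s ^ (b + 3) / (b + 3) else 0) hu]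
      · refine finsum_congr fun b => ?_
        rw [finsum_eq_if]
        split_ifs with hb
        · rw [hpint b (by linarith)]
        · simp
      · intro b hb
        rw [if_neg (by linarith)]
    have e2 : ∫ n : S2, prodCoeff y c φ (-3) n ∂dOmega
        = ∑ a ∈ A, ∑ j ∈ Finset.range M, (if a + j = -3 then 1 else 0) * I φ a j := by
      rw [← reindex A M 0 (I φ) (fun b => if b = -3 then 1 else 0) hu]
      · rw [finsum_eq_single _ (-3 : ℝ)]
        · rw [if_pos rfl, one_mul, hpint _ (by norm_num)]
        · intro b hb; simp [hb]
      · intro b hb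
        rw [if_neg (by linarith)]
    have hDi : ∀ a j, IntegrableOn (tm φ a j) (Metric.ball y R \ Metric.closedBall y s) :=
      fun a j => ann_integrable y s R hs.1 _ (htmc φ a j)
    have hsub : Metric.ball y R \ Metric.closedBall y s ⊆ Bp := by
      rintro x ⟨hx1, hx2⟩
      refine ⟨hx1, ?_⟩
      rintro rfl
      exact hx2 (Metric.mem_closedBall_self hs.1.le)
    have e3 : ∫ x in Metric.ball y R \ Metric.closedBall y s, F x * φ x
        = (∫ x in Metric.ball y R \ Metric.closedBall y s, H φ x)
          + ∑ a ∈ A, ∑ j ∈ Finset.range M, (∫ r in s..R, r ^ (a + j + 2)) * I φ a j := by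
      have : ∀ x, F x * φ x = H φ x + ∑ a ∈ A, ∑ j ∈ Finset.range M, tm φ a j x := by
        intro x; simp only [H, D]; ring
      simp_rw [this]
      rw [integral_add ((hHi φ hφ hφc).mono_set hsub)
        (integrable_finsetSum _ fun a _ => integrable_finsetSum _ fun j _ => hDi a j),
        integral_finsetSum _ fun a _ => integrable_finsetSum _ fun j _ => hDi a j]
      congr 1
      refine Finset.sum_congr rfl fun a _ => ?_
      rw [integral_finsetSum _ fun j _ => hDi a j]
      refine Finset.sum_congr rfl fun j _ => ?_
      have := polar_integral' y (a + j) s R hs.1 hs.2 (fun v => g a v * tay y φ j v)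
      simp only [hgc] at this
      exact this
    rw [e1, e2, e3, Finset.mul_sum, add_assoc, add_assoc, ← Finset.sum_add_distrib,
      ← Finset.sum_add_distrib]
    congr 1
    refine Finset.sum_congr rfl fun a _ => ?_
    rw [Finset.mul_sum, ← Finset.sum_add_distrib, ← Finset.sum_add_distrib]
    refine Finset.sum_congr rfl fun j _ => ?_
    ring
  · intro φ ψ hφ hφc hψ hψc
    have hH : ∀ x, H (φ + ψ) x = H φ x + H ψ x := by
      intro x
      simp only [H, D, tm, tay_add y φ ψ hφ hψ, mul_add, Finset.sum_add_distrib, Pi.add_apply]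
      ring
    have hI : ∀ a j, I (φ + ψ) a j = I φ a j + I ψ a j := by
      intro a j
      simp only [I, tay_add y φ ψ hφ hψ, mul_add]
      exact integral_add (hIint φ a j) (hIint ψ a j)
    simp only [T, hH, hI, mul_add, Finset.sum_add_distrib]
    rw [integral_add (hHi φ hφ hφc) (hHi ψ hψ hψc)]
    ring
  · intro r φ hφ hφc
    have hH : ∀ x, H (r • φ) x = r * H φ x := by
      intro x
      simp only [H, D, tm, tay_const_smul y r φ hφ, Pi.smul_apply, smul_eq_mul, mul_sub,
        Finset.mul_sum]
      congr 1
      · ring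
      · refine Finset.sum_congr rfl fun a _ => Finset.sum_congr rfl fun j _ => ?_
        ring
    have hI : ∀ a j, I (r • φ) a j = r * I φ a j := by
      intro a j
      simp only [I, tay_const_smul y r φ hφ, mul_left_comm _ r]
      exact integral_const_mul r _
    simp only [T, hH, hI, mul_left_comm _ r, ← Finset.mul_sum]
    rw [integral_const_mul]
    ring
  · intro φ B hφ hB
    have hB0 : 0 ≤ B := (norm_nonneg _).trans (hB 0 (Nat.zero_le _) 0)
    have b1 : |∫ x in Bp, H φ x| ≤ B * volume.real Bp :=
      norm_setIntegral_le_of_norm_le_const hBpfin (hHb φ B hφ hB)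
    have b2 : ∀ a, ∀ j ∈ Finset.range M, |I φ a j| ≤ Cc a * B * dOmega.real Set.univ := by
      intro a j hj
      refine norm_integral_le_of_norm_le_const (μ := dOmega)
        (f := fun n : S2 => c a n * tay y φ j n) (Eventually.of_forall fun n => ?_)
      have hn1 : ‖(n:E3)‖ = 1 := by simp
      rw [norm_mul]
      exact mul_le_mul (hcb a n) (tay_bound y φ j B (hB j (Finset.mem_range.1 hj).le y) n hn1)
        (abs_nonneg _) (hc0 a)
    refine (abs_add_le _ _).trans ?_
    rw [add_mul, Finset.sum_mul]
    refine add_le_add (by linarith) ?_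
    refine (Finset.abs_sum_le_sum_abs _ _).trans (Finset.sum_le_sum fun a _ => ?_)
    rw [Finset.sum_mul]
    refine (Finset.abs_sum_le_sum_abs _ _).trans (Finset.sum_le_sum fun j hj => ?_)
    rw [abs_mul]
    calc _ ≤ |wgt R s₁ (a + j)| * (Cc a * B * dOmega.real Set.univ) := by
          gcongr; exact b2 a j hj
      _ = _ := by ring

/-- pseudo-functions restricted to test functions are Schwartz
distributions: for every `φ ∈ C_c^∞`, `Pf ∫ Fφ` exists; the resulting functional
`T = ⟨PfF, ·⟩` is linear; and it is sequentially continuous for the Schwartz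
test-function convergence. -/
theorem pf_pseudo_function_is_distribution
    (y₁ y₂ : E3) (hy : y₁ ≠ y₂) (s₁ s₂ : ℝ) (hs₁ : 0 < s₁) (hs₂ : 0 < s₂)
    (F : E3 → ℝ) (c d : ℝ → S2 → ℝ) (hF : MemF y₁ y₂ F c d) :
    ∃ T : (E3 → ℝ) → ℝ,
      -- existence of the bracket ⟨PfF, φ⟩ = Pf ∫ Fφ for every test function φ
      (∀ φ : E3 → ℝ, ContDiff ℝ (⊤ : ℕ∞) φ → HasCompactSupport φ →
        ∃ p q : ℝ → S2 → ℝ,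
          HasSingExpansion y₁ (fun x => F x * φ x) p
          ∧ HasSingExpansion y₂ (fun x => F x * φ x) q
          ∧ HasPfIntegral y₁ y₂ s₁ s₂ (fun x => F x * φ x) p q (T φ))
      -- linearity
      ∧ (∀ φ ψ : E3 → ℝ, ContDiff ℝ (⊤ : ℕ∞) φ → HasCompactSupport φ →
          ContDiff ℝ (⊤ : ℕ∞) ψ → HasCompactSupport ψ → T (φ + ψ) = T φ + T ψ)
      ∧ (∀ (r : ℝ) (φ : E3 → ℝ), ContDiff ℝ (⊤ : ℕ∞) φ → HasCompactSupport φ →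
          T (r • φ) = r * T φ)
      -- continuity with respect to Schwartz test-function convergence
      ∧ ∀ (K : Set E3), IsCompact K →
          ∀ φs : ℕ → E3 → ℝ,
            (∀ m : ℕ, ContDiff ℝ (⊤ : ℕ∞) (φs m) ∧ HasCompactSupport (φs m)
              ∧ tsupport (φs m) ⊆ K) →
            (∀ k : ℕ, TendstoUniformly (fun m => iteratedFDeriv ℝ k (φs m)) 0 atTop) →
            Tendsto (fun m => T (φs m)) atTop (𝓝 0) := by
  obtain ⟨R₁, hR₁, near₁⟩ := near_exists hF.exp₁ s₁ hs₁
  obtain ⟨R₂, hR₂, near₂⟩ := near_exists hF.exp₂ s₂ hs₂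
  have hdist : 0 < dist y₁ y₂ := dist_pos.2 hy
  obtain ⟨R, hR0, hRlt⟩ := exists_between (lt_min (lt_min hR₁ hR₂) (half_pos hdist))
  have hRR₁ : R < R₁ := hRlt.trans_le ((min_le_left _ _).trans (min_le_left _ _))
  have hRR₂ : R < R₂ := hRlt.trans_le ((min_le_left _ _).trans (min_le_right _ _))
  have hRd : R < dist y₁ y₂ / 2 := hRlt.trans_le (min_le_right _ _)
  have hFc : ContinuousOn F ({y₁, y₂}ᶜ : Set E3) := hF.smooth.continuousOn
  have hsub₁ : Metric.closedBall y₁ R \ {y₁} ⊆ ({y₁, y₂}ᶜ : Set E3) := by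
    rintro x ⟨hx, hne⟩ hmem
    rcases hmem with h | h
    · exact hne h
    · rw [Set.mem_singleton_iff] at h
      rw [h, Metric.mem_closedBall, dist_comm] at hx
      linarith
  have hsub₂ : Metric.closedBall y₂ R \ {y₂} ⊆ ({y₁, y₂}ᶜ : Set E3) := by
    rintro x ⟨hx, hne⟩ hmem
    rcases hmem with h | h
    · rw [h, Metric.mem_closedBall] at hx
      linarith
    · exact hne h
  obtain ⟨T₁, M₁, C₁, lim₁, add₁, smul₁, bd₁⟩ := near₁ R hR0 hRR₁ (hFc.mono hsub₁)
  obtain ⟨T₂, M₂, C₂, lim₂, add₂, smul₂, bd₂⟩ := near₂ R hR0 hRR₂ (hFc.mono hsub₂)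
  set Out : Set E3 := (Metric.ball y₁ R ∪ Metric.ball y₂ R)ᶜ with hOut
  have hOutc : IsClosed Out := (Metric.isOpen_ball.union Metric.isOpen_ball).isClosed_compl
  have hOutF : ContinuousOn F Out := by
    apply hFc.mono
    rintro x hx hmem
    apply hx
    rcases hmem with h | h
    · left; rw [h]; exact Metric.mem_ball_self hR0
    · right; rw [Set.mem_singleton_iff] at h; rw [h]; exact Metric.mem_ball_self hR0
  have hOuti : ∀ φ : E3 → ℝ, ContDiff ℝ (⊤ : ℕ∞) φ → HasCompactSupport φ →
      IntegrableOn (fun x => F x * φ x) Out := by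
    intro φ hφ hφc
    have h1 : IntegrableOn (fun x => F x * φ x) (Out ∩ tsupport φ) :=
      ContinuousOn.integrableOn_compact (hK := hφc.isCompact.inter_left hOutc)
        ((hOutF.mul hφ.continuous.continuousOn).mono Set.inter_subset_left)
    refine h1.of_forall_sdiff_eq_zero hOutc.measurableSet ?_
    rintro x ⟨hx1, hx2⟩
    have : x ∉ tsupport φ := fun h => hx2 ⟨hx1, h⟩
    rw [image_eq_zero_of_notMem_tsupport this, mul_zero]
  have hann : ∀ (y : E3), Metric.closedBall y R \ {y} ⊆ ({y₁, y₂}ᶜ : Set E3) →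
      ∀ φ : E3 → ℝ, ContDiff ℝ (⊤ : ℕ∞) φ → ∀ s, 0 < s →
      IntegrableOn (fun x => F x * φ x) (Metric.ball y R \ Metric.closedBall y s) := by
    intro y hy' φ hφ s hs
    have hK : IsCompact (Metric.closedBall y R \ Metric.ball y s) :=
      (isCompact_closedBall y R).diff Metric.isOpen_ball
    have : IntegrableOn (fun x => F x * φ x) (Metric.closedBall y R \ Metric.ball y s) := by
      refine ContinuousOn.integrableOn_compact (hK := hK) ?_
      refine (hFc.mul hφ.continuous.continuousOn).mono (Set.Subset.trans ?_ hy')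
      rintro x ⟨hx1, hx⟩
      refine ⟨hx1, ?_⟩
      rintro rfl
      exact hx (Metric.mem_ball_self hs)
    exact this.mono_set (Set.sdiff_subset_sdiff Metric.ball_subset_closedBall
      Metric.ball_subset_closedBall)
  refine ⟨fun φ => (∫ x in Out, F x * φ x) + T₁ φ + T₂ φ, ?_, ?_, ?_, ?_⟩
  · intro φ hφ hφc
    refine ⟨prodCoeff y₁ c φ, prodCoeff y₂ d φ, sing_mul hF.exp₁ φ hφ hφc,
      sing_mul hF.exp₂ φ hφ hφc, ?_⟩
    unfold HasPfIntegral
    have hl := ((tendsto_const_nhds (x := ∫ x in Out, F x * φ x)).add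
      (lim₁ φ hφ hφc)).add (lim₂ φ hφ hφc)
    apply hl.congr'
    filter_upwards [Ioo_mem_nhdsGT hR0] with s hs
    have hdisj : ∀ x, dist x y₁ < R → dist x y₂ < R → False := by
      intro x h1 h2
      have := dist_triangle_left y₁ y₂ x
      linarith
    have hset : (Metric.closedBall y₁ s ∪ Metric.closedBall y₂ s)ᶜ
        = (Out ∪ (Metric.ball y₁ R \ Metric.closedBall y₁ s))
          ∪ (Metric.ball y₂ R \ Metric.closedBall y₂ s) := by
      ext x
      have := hdisj x
      have hsR := hs.2
      simp only [hOut, Set.mem_compl_iff, Set.mem_union, Metric.mem_closedBall, Metric.mem_ball,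
        Set.mem_sdiff, not_or, not_le, not_lt]
      constructor
      · rintro ⟨h1, h2⟩
        by_cases k1 : dist x y₁ < R
        · exact Or.inl (Or.inr ⟨k1, h1⟩)
        · by_cases k2 : dist x y₂ < R
          · exact Or.inr ⟨k2, h2⟩
          · exact Or.inl (Or.inl ⟨not_lt.1 k1, not_lt.1 k2⟩)
      · rintro ((⟨h1, h2⟩ | ⟨h1, h2⟩) | ⟨h1, h2⟩)
        · exact ⟨by linarith, by linarith⟩
        · refine ⟨h2, ?_⟩
          by_contra hn
          exact this h1 (by linarith)
        · refine ⟨?_, h2⟩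
          by_contra hn
          exact this (by linarith) h1
    have hintegral : ∫ x in (Metric.closedBall y₁ s ∪ Metric.closedBall y₂ s)ᶜ, F x * φ x
        = (∫ x in Out, F x * φ x)
          + (∫ x in Metric.ball y₁ R \ Metric.closedBall y₁ s, F x * φ x)
          + ∫ x in Metric.ball y₂ R \ Metric.closedBall y₂ s, F x * φ x := by
      have i0 := hOuti φ hφ hφc
      have i1 := hann y₁ hsub₁ φ hφ s hs.1
      have i2 := hann y₂ hsub₂ φ hφ s hs.1
      rw [hset, setIntegral_union _ (measurableSet_ball.diff measurableSet_closedBall)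
        (i0.union i1) i2, setIntegral_union _ (measurableSet_ball.diff measurableSet_closedBall)
        i0 i1]
      · rw [Set.disjoint_left]
        intro x hx hx'
        exact hx (Or.inl hx'.1)
      · rw [Set.disjoint_left]
        rintro x (hx | hx) hx'
        · exact hx (Or.inr hx'.1)
        · exact hdisj x hx.1 hx'.1
    unfold pfApprox
    rw [hintegral]
    ring
  · intro φ ψ hφ hφc hψ hψc
    have : ∫ x in Out, F x * (φ + ψ) x = (∫ x in Out, F x * φ x) + ∫ x in Out, F x * ψ x := by
      rw [← integral_add (hOuti φ hφ hφc) (hOuti ψ hψ hψc)]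
      simp only [Pi.add_apply, mul_add]
    simp only [this, add₁ φ ψ hφ hφc hψ hψc, add₂ φ ψ hφ hφc hψ hψc]
    ring
  · intro r φ hφ hφc
    have : ∫ x in Out, F x * (r • φ) x = r * ∫ x in Out, F x * φ x := by
      rw [← integral_const_mul]
      simp only [Pi.smul_apply, smul_eq_mul, mul_left_comm]
    simp only [this, smul₁ r φ hφ hφc, smul₂ r φ hφ hφc]
    ring
  · intro K hK φs hφs hconv
    have hFi : IntegrableOn F (Out ∩ K) :=
      ContinuousOn.integrableOn_compact (hK := hK.inter_left hOutc)
        (hOutF.mono Set.inter_subset_left)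
    set Q := ∫ x in Out ∩ K, ‖F x‖ with hQ
    have hbound : ∀ m B, (∀ j ≤ max M₁ M₂, ∀ x, ‖iteratedFDeriv ℝ j (φs m) x‖ ≤ B) →
        |(∫ x in Out, F x * φs m x) + T₁ (φs m) + T₂ (φs m)| ≤ (Q + C₁ + C₂) * B := by
      intro m B hB
      obtain ⟨h1, h2, h3⟩ := hφs m
      have k1 := bd₁ (φs m) B h1 fun j hj => hB j (hj.trans (le_max_left _ _))
      have k2 := bd₂ (φs m) B h1 fun j hj => hB j (hj.trans (le_max_right _ _))
      have k0 : |∫ x in Out, F x * φs m x| ≤ Q * B := by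
        have : ∫ x in Out, F x * φs m x = ∫ x in Out ∩ K, F x * φs m x := by
          refine (setIntegral_eq_of_subset_of_forall_sdiff_eq_zero hOutc.measurableSet
            Set.inter_subset_left ?_)
          rintro x ⟨hx1, hx2⟩
          have : x ∉ tsupport (φs m) := fun h => hx2 ⟨hx1, h3 h⟩
          rw [image_eq_zero_of_notMem_tsupport this, mul_zero]
        rw [this, hQ, ← integral_mul_const, ← Real.norm_eq_abs]
        refine norm_integral_le_of_norm_le (hFi.norm.mul_const B) (Eventually.of_forall fun x => ?_)
        rw [norm_mul]
        have := hB 0 (Nat.zero_le _) x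
        rw [norm_iteratedFDeriv_zero] at this
        gcongr
      have := abs_add_three (∫ x in Out, F x * φs m x) (T₁ (φs m)) (T₂ (φs m))
      nlinarith
    rw [Metric.tendsto_atTop']
    intro ε hε
    set C := |Q + C₁ + C₂| + 1 with hC
    have hCpos : 0 < C := by positivity
    have hev : ∀ᶠ m in atTop, ∀ j ∈ Finset.range (max M₁ M₂ + 1), ∀ x,
        ‖iteratedFDeriv ℝ j (φs m) x‖ ≤ ε / (2 * C) := by
      rw [Filter.eventually_all_finset]
      intro j _
      filter_upwards [Metric.tendstoUniformly_iff.1 (hconv j) (ε / (2 * C)) (by positivity)]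
        with m hm x
      have := hm x
      rw [Pi.zero_apply, dist_zero_left] at this
      exact this.le
    obtain ⟨m₀, hm₀⟩ := eventually_atTop.1 hev
    refine ⟨m₀, fun m hm => ?_⟩
    rw [Real.dist_eq, sub_zero]
    have := hbound m (ε / (2 * C)) fun j hj => hm₀ m hm.le j (Finset.mem_range.2 (by omega))
    refine this.trans_lt ?_
    calc (Q + C₁ + C₂) * (ε / (2 * C)) ≤ C * (ε / (2 * C)) := by
          gcongr
          rw [hC]
          linarith [le_abs_self (Q + C₁ + C₂)]
      _ = ε / 2 := by field_simp
      _ < ε := half_lt_self hε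

end
end

section
/- (Characterization of derivative operators satisfying the rule of integration by parts.) Let 𝓕₀ ⊂ 𝓕 be a set of functions with integer exponents, closed under products and under ∂_i, all of whose elements have derivatives admitting singular expansions and decay fast enough at infinity that for all F, G ∈ 𝓕₀ the brackets ⟨PfF, G⟩ := Pf_{s₁,s₂} ∫ F G d³x and ⟨Pf(∂_iF), G⟩ exist. Let D assign to each F ∈ 𝓕₀ a functional G ↦ ⟨D[F], G⟩ on 𝓕₀, and define ⟨∂_i(PfF), G⟩ := ⟨Pf(∂_iF), G⟩ + ⟨D[F], G⟩. Then the rule of integration by parts ⟨∂_i(PfF), G⟩ = −⟨∂_i(PfG), F⟩ holds for all F, G ∈ 𝓕₀ if and only if ⟨D[F], G⟩ + ⟨D[G], F⟩ = 4π (n₁ⁱ r₁² F G)₁ + 4π (n₂ⁱ r₂² F G)₂ for all F, G ∈ 𝓕₀. Moreover the particular choice ⟨D^part[F], G⟩ := ∫_{S²} nⁱ [ (1/2) f_{−1} g'_{−1} + Σ_{k ≥ 0} f_{−2−k} g'_k ] dΩ + (the corresponding expression at y₂), where (f_a) and (g'_a) are the expansion coefficients at y₁ of F and G respectively, satisfies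 this relation; hence every D satisfying the rule equals D^part plus an antisymmetric term H, i.e. ⟨H[F], G⟩ + ⟨H[G], F⟩ = 0 for all F, G ∈ 𝓕₀. -/
open MeasureTheory Filter Topology Real Asymptotics

noncomputable section

/-- The particular distributional term
`⟨D^part[F], G⟩ = ∫ nⁱ [½ f₋₁ g'₋₁ + Σ_{k≥0} f₋₂₋ₖ g'ₖ] dΩ + (1 ↔ 2)`,
expressed through the coefficient assignments `cf₁` (at `y₁`) and `cf₂` (at `y₂`). -/
def DpartBracket (cf₁ cf₂ : (E3 → ℝ) → ℝ → S2 → ℝ) (i : Fin 3) (F G : E3 → ℝ) : ℝ :=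
  (∫ n : S2, (n : E3) i *
      ((1 / 2) * cf₁ F (-1) n * cf₁ G (-1) n
        + ∑ᶠ k : ℕ, cf₁ F (-2 - (k : ℝ)) n * cf₁ G (k : ℝ) n) ∂dOmega)
  + ∫ n : S2, (n : E3) i *
      ((1 / 2) * cf₂ F (-1) n * cf₂ G (-1) n
        + ∑ᶠ k : ℕ, cf₂ F (-2 - (k : ℝ)) n * cf₂ G (k : ℝ) n) ∂dOmega

/-- `4π (n₁ⁱ r₁² F G)₁ + 4π (n₂ⁱ r₂² F G)₂`, expressed through the coefficient
assignments `cf₁`, `cf₂` applied to the product `FG`. -/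
def surfaceTerm (cf₁ cf₂ : (E3 → ℝ) → ℝ → S2 → ℝ) (i : Fin 3) (F G : E3 → ℝ) : ℝ :=
  (∫ n : S2, (n : E3) i * cf₁ (fun x => F x * G x) (-2) n ∂dOmega)
  + ∫ n : S2, (n : E3) i * cf₂ (fun x => F x * G x) (-2) n ∂dOmega

lemma aux_rpow_zero {a : ℝ} (ha : 0 < a) : Tendsto (fun s : ℝ => s ^ a) (𝓝[>] 0) (𝓝 0) := by
  have h := (Real.continuousAt_rpow_const 0 a (Or.inr ha.le)).tendsto
  rw [Real.zero_rpow ha.ne'] at h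
  exact h.mono_left nhdsWithin_le_nhds

lemma asym_distinct (T : Finset ℝ) (k : ℝ → ℝ) (κ M : ℝ)
    (h : ∀ᶠ s in 𝓝[>] (0 : ℝ), |∑ a ∈ T, s ^ a * k a + κ * Real.log s| ≤ M) :
    κ = 0 ∧ ∀ a ∈ T, a < 0 → k a = 0 := by
  have key : ∀ a ∈ T, a < 0 → k a = 0 := by
    by_contra hcon
    push Not at hcon
    obtain ⟨a0, ha0T, ha0, hk0⟩ := hcon
    have hne : (T.filter (fun a => a < 0 ∧ k a ≠ 0)).Nonempty :=
      ⟨a0, by simp [ha0T, ha0, hk0]⟩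
    obtain ⟨a, haF, hmin⟩ := Finset.exists_min_image _ id hne
    simp only [Finset.mem_filter, id] at haF hmin
    obtain ⟨haT, haneg, hka⟩ := haF
    have hlim0 : Tendsto (fun s : ℝ => s ^ (-a) * (∑ a ∈ T, s ^ a * k a + κ * Real.log s))
        (𝓝[>] 0) (𝓝 0) := by
      have hz : Tendsto (fun s : ℝ => s ^ (-a) * M) (𝓝[>] 0) (𝓝 0) := by
        simpa using (aux_rpow_zero (neg_pos.2 haneg)).mul_const M
      refine squeeze_zero_norm' ?_ hz
      filter_upwards [h, self_mem_nhdsWithin] with s hs hs0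
      have hs0 : (0:ℝ) < s := hs0
      rw [Real.norm_eq_abs, abs_mul, abs_of_nonneg (Real.rpow_nonneg hs0.le _)]
      exact mul_le_mul_of_nonneg_left hs (Real.rpow_nonneg hs0.le _)
    have hlim1 : Tendsto (fun s : ℝ => ∑ b ∈ T, s ^ (b - a) * k b + κ * (Real.log s * s ^ (-a)))
        (𝓝[>] 0) (𝓝 (∑ b ∈ T, (if b = a then k a else 0) + κ * 0)) := by
      refine Tendsto.add (tendsto_finsetSum _ fun b hb => ?_)
        ((tendsto_log_mul_rpow_nhdsGT_zero (neg_pos.2 haneg)).const_mul κ)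
      split_ifs with hba
      · subst hba; simp
      · rcases lt_or_gt_of_ne hba with hlt | hgt
        · have : k b = 0 := by
            by_contra hkb
            exact absurd (hmin b ⟨hb, hlt.trans haneg, hkb⟩) (not_le.2 hlt)
          simp [this]
        · simpa using (aux_rpow_zero (sub_pos.2 hgt)).mul_const (k b)
    have heq : (fun s : ℝ => s ^ (-a) * (∑ a ∈ T, s ^ a * k a + κ * Real.log s)) =ᶠ[𝓝[>] 0]
        (fun s : ℝ => ∑ b ∈ T, s ^ (b - a) * k b + κ * (Real.log s * s ^ (-a))) := by
      filter_upwards [self_mem_nhdsWithin] with s hs0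
      have hs0 : (0:ℝ) < s := hs0
      rw [mul_add, Finset.mul_sum]
      congr 1
      · refine Finset.sum_congr rfl fun b _ => ?_
        rw [← mul_assoc, ← Real.rpow_add hs0, neg_add_eq_sub]
      · ring
    have := tendsto_nhds_unique (hlim0.congr' heq) hlim1
    simp [haT] at this
    exact hka this.symm
  refine ⟨?_, key⟩
  by_contra hκ
  have hb : ∀ᶠ s in 𝓝[>] (0 : ℝ), |κ * Real.log s| ≤ M + ∑ a ∈ T, |k a| := by
    have h1 : ∀ᶠ s in 𝓝[>] (0 : ℝ), s < 1 :=
      nhdsWithin_le_nhds (gt_mem_nhds one_pos)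
    filter_upwards [h, h1, self_mem_nhdsWithin] with s hs hs1 hs0
    have hs0 : (0:ℝ) < s := hs0
    have h2 : |∑ a ∈ T, s ^ a * k a| ≤ ∑ a ∈ T, |k a| := by
      refine (Finset.abs_sum_le_sum_abs _ _).trans (Finset.sum_le_sum fun a ha => ?_)
      rcases lt_or_ge a 0 with hlt | hge
      · simp [key a ha hlt]
      · rw [abs_mul, abs_of_nonneg (Real.rpow_nonneg hs0.le _)]
        exact mul_le_of_le_one_left (abs_nonneg _) (Real.rpow_le_one hs0.le hs1.le hge)
    have h3 := abs_sub_abs_le_abs_sub (κ * Real.log s) (-(∑ a ∈ T, s ^ a * k a))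
    rw [abs_neg, sub_neg_eq_add, add_comm (κ * Real.log s)] at h3
    linarith
  have hlog : Tendsto (fun s : ℝ => |κ * Real.log s|) (𝓝[>] 0) atTop := by
    have : Tendsto (fun s : ℝ => |κ| * |Real.log s|) (𝓝[>] 0) atTop :=
      (tendsto_abs_atBot_atTop.comp Real.tendsto_log_nhdsGT_zero).const_mul_atTop (abs_pos.2 hκ)
    simpa [abs_mul] using this
  have h4 := hlog.eventually (eventually_gt_atTop (M + ∑ a ∈ T, |k a|))
  obtain ⟨s, hs1, hs2⟩ := (hb.and h4).exists
  linarith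

lemma asym_indexed {ι : Type*} (I : Finset ι) (e k : ι → ℝ) (κ M : ℝ)
    (h : ∀ᶠ s in 𝓝[>] (0 : ℝ), |∑ j ∈ I, s ^ e j * k j + κ * Real.log s| ≤ M) :
    κ = 0 ∧ (∀ b < 0, ∑ j ∈ I with e j = b, k j = 0) ∧
    Tendsto (fun s : ℝ => ∑ j ∈ I, s ^ e j * k j) (𝓝[>] 0) (𝓝 (∑ j ∈ I with e j = 0, k j)) := by
  classical
  have hfib : ∀ s : ℝ, ∑ j ∈ I, s ^ e j * k j
      = ∑ a ∈ I.image e, s ^ a * ∑ j ∈ I with e j = a, k j := by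
    intro s
    rw [← Finset.sum_fiberwise_of_maps_to (g := e) (t := I.image e)
      (fun j hj => Finset.mem_image_of_mem e hj)]
    refine Finset.sum_congr rfl fun a _ => ?_
    rw [Finset.mul_sum]
    refine Finset.sum_congr rfl fun j hj => ?_
    rw [(Finset.mem_filter.1 hj).2]
  simp_rw [hfib] at h ⊢
  obtain ⟨h1, h2⟩ := asym_distinct _ _ κ M h
  have h2' : ∀ b < 0, ∑ j ∈ I with e j = b, k j = 0 := by
    intro b hb
    by_cases hbI : b ∈ I.image e
    · exact h2 b hbI hb
    · refine Finset.sum_eq_zero fun j hj => ?_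
      exfalso
      simp only [Finset.mem_filter] at hj
      exact hbI (hj.2 ▸ Finset.mem_image_of_mem e hj.1)
  refine ⟨h1, h2', ?_⟩
  have : (∑ j ∈ I with e j = 0, k j)
      = ∑ a ∈ I.image e, if a = 0 then (∑ j ∈ I with e j = 0, k j) else 0 := by
    rw [Finset.sum_ite_eq']
    split_ifs with h0
    · rfl
    · refine Finset.sum_eq_zero fun j hj => ?_
      exfalso
      simp only [Finset.mem_filter] at hj
      exact h0 (hj.2 ▸ Finset.mem_image_of_mem e hj.1)
  rw [this]
  refine tendsto_finsetSum _ fun a _ => ?_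
  split_ifs with ha
  · subst ha; simp
  · rcases lt_or_gt_of_ne ha with hlt | hgt
    · simp [h2' a hlt]
    · simpa using (aux_rpow_zero hgt).mul_const _

lemma exp_finset {y : E3} {F : E3 → ℝ} {c : ℝ → S2 → ℝ} (h : HasSingExpansion y F c) (N : ℕ) :
    ∃ T : Finset ℝ, (∀ a, a ∈ T ↔ a ≤ (N : ℝ) ∧ c a ≠ 0) ∧
      ∀ ε > 0, ∃ δ > 0, ∀ r : ℝ, 0 < r → r < δ → ∀ n : S2,
        |F (y + r • (n : E3)) - ∑ a ∈ T, r ^ a * c a n| ≤ ε * r ^ (N : ℝ) := by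
  have hf := h.finite_exponents N
  refine ⟨hf.toFinset, fun a => by simp, fun ε hε => ?_⟩
  obtain ⟨δ, hδ, H⟩ := h.expansion N ε hε
  refine ⟨δ, hδ, fun r hr hrd n => ?_⟩
  have := H r hr hrd n
  rwa [show (∑ᶠ (a : ℝ) (_ : a ≤ (N : ℝ)), r ^ a * c a n) = ∑ a ∈ hf.toFinset, r ^ a * c a n from ?_]
    at this
  refine finsum_mem_eq_sum_of_inter_support_eq (s := {a : ℝ | a ≤ (N : ℝ)}) _ ?_
  ext a
  simp only [Set.mem_inter_iff, Set.mem_ofPred_eq, Function.mem_support, Set.Finite.coe_toFinset]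
  constructor
  · rintro ⟨h1, h2⟩
    exact ⟨⟨h1, fun h0 => h2 (by simp [h0])⟩, h2⟩
  · rintro ⟨⟨h1, _⟩, h2⟩
    exact ⟨h1, h2⟩

lemma exp_add {y : E3} {F G : E3 → ℝ} {c d : ℝ → S2 → ℝ} (hF : HasSingExpansion y F c)
    (hG : HasSingExpansion y G d) : HasSingExpansion y (fun x => F x + G x) (c + d) where
  smooth_coeffs a := by
    obtain ⟨f, hf, hf'⟩ := hF.smooth_coeffs a
    obtain ⟨g, hg, hg'⟩ := hG.smooth_coeffs a
    exact ⟨fun x => f x + g x, hf.add hg, fun n => by simp [hf', hg']⟩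
  bddBelow := by
    obtain ⟨a, ha⟩ := hF.bddBelow
    obtain ⟨b, hb⟩ := hG.bddBelow
    refine ⟨min a b, fun x hx => ?_⟩
    rw [lt_min_iff] at hx
    simp [ha x hx.1, hb x hx.2]
  finite_exponents N := by
    refine ((hF.finite_exponents N).union (hG.finite_exponents N)).subset ?_
    rintro a ⟨h1, h2⟩
    by_contra hcon
    simp only [Set.mem_union, Set.mem_ofPred_eq, h1, true_and, not_or, not_not] at hcon
    exact h2 (by simp [hcon.1, hcon.2])
  expansion N ε hε := by
    obtain ⟨δ1, hδ1, H1⟩ := hF.expansion N (ε / 2) (by positivity)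
    obtain ⟨δ2, hδ2, H2⟩ := hG.expansion N (ε / 2) (by positivity)
    refine ⟨min δ1 δ2, lt_min hδ1 hδ2, fun r hr hrd n => ?_⟩
    rw [lt_min_iff] at hrd
    have h1 := H1 r hr hrd.1 n
    have h2 := H2 r hr hrd.2 n
    have fin : ∀ e : ℝ → S2 → ℝ, {a : ℝ | a ≤ N ∧ e a ≠ 0}.Finite →
        ({a : ℝ | a ≤ (N:ℝ)} ∩ Function.support fun a => r ^ a * e a n).Finite := by
      intro e he
      refine he.subset ?_
      rintro a ⟨h1, h2⟩
      exact ⟨h1, fun h0 => h2 (by simp [h0])⟩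
    have hs : (∑ᶠ (a : ℝ) (_ : a ≤ (N : ℝ)), r ^ a * (c + d) a n)
        = (∑ᶠ (a : ℝ) (_ : a ≤ (N : ℝ)), r ^ a * c a n)
          + ∑ᶠ (a : ℝ) (_ : a ≤ (N : ℝ)), r ^ a * d a n := by
      simp only [Pi.add_apply, mul_add]
      exact finsum_mem_add_distrib' (s := {a : ℝ | a ≤ (N : ℝ)}) (fin c (hF.finite_exponents N))
        (fin d (hG.finite_exponents N))
    rw [hs]
    rw [abs_le] at h1 h2 ⊢
    constructor <;> linarith [h1.1, h1.2, h2.1, h2.2]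

lemma smooth_cont {f : S2 → ℝ} (h : SmoothSphereFn f) : Continuous f := by
  obtain ⟨g, hg, hf⟩ := h
  have : f = fun n : S2 => g (n : E3) := by ext n; exact (hf n).symm
  rw [this]
  exact hg.continuous.comp continuous_subtype_val

lemma cont_int {f : S2 → ℝ} (h : Continuous f) : Integrable f dOmega :=
  h.integrable_of_hasCompactSupport (HasCompactSupport.of_compactSpace f)

/-- Integrated expansion, with weight. -/
lemma exp_int {y : E3} {F : E3 → ℝ} {c : ℝ → S2 → ℝ} (h : HasSingExpansion y F c)
    (w : S2 → ℝ) (hw : Continuous w) (hw1 : ∀ n, |w n| ≤ 1)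
    (hFc : ∀ᶠ r in 𝓝[>] (0:ℝ), Continuous fun n : S2 => F (y + r • (n : E3)))
    (T : Finset ℝ) (hT : ∀ a, a ∈ T ↔ a ≤ ((0 : ℕ) : ℝ) ∧ c a ≠ 0) :
    ∀ᶠ r in 𝓝[>] (0:ℝ), |(∫ n : S2, w n * F (y + r • (n : E3)) ∂dOmega)
      - ∑ a ∈ T, r ^ a * ∫ n : S2, w n * c a n ∂dOmega| ≤ dOmega.real Set.univ := by
  obtain ⟨T', hT', H⟩ := exp_finset h 0
  have : T' = T := by ext a; rw [hT, hT']
  subst this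
  obtain ⟨δ, hδ, H⟩ := H 1 one_pos
  filter_upwards [hFc, Ioo_mem_nhdsGT hδ] with r hr hrd
  have hc : ∀ a, Continuous (c a) := fun a => smooth_cont (h.smooth_coeffs a)
  have e1 : ∑ a ∈ T', r ^ a * ∫ n : S2, w n * c a n ∂dOmega
      = ∫ n : S2, ∑ a ∈ T', r ^ a * (w n * c a n) ∂dOmega := by
    rw [integral_finsetSum]
    · refine Finset.sum_congr rfl fun a _ => ?_
      rw [integral_const_mul]
    · intro a _
      exact cont_int (continuous_const.mul (hw.mul (hc a)))
  have i1 : Integrable (fun n : S2 => w n * F (y + r • (n : E3))) dOmega := cont_int (hw.mul hr)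
  have i2 : Integrable (fun n : S2 => ∑ a ∈ T', r ^ a * (w n * c a n)) dOmega :=
    cont_int (continuous_finsetSum _ fun a _ => continuous_const.mul (hw.mul (hc a)))
  rw [e1, ← integral_sub i1 i2]
  have := norm_integral_le_of_norm_le_const (μ := dOmega) (C := 1)
    (f := fun n : S2 => w n * F (y + r • (n : E3)) - ∑ a ∈ T', r ^ a * (w n * c a n))
    (Eventually.of_forall fun n => ?_)
  · simpa using this
  · have h1 := H r hrd.1 hrd.2 n
    simp only [Nat.cast_zero, Real.rpow_zero, mul_one] at h1
    have : w n * F (y + r • (n : E3)) - ∑ a ∈ T', r ^ a * (w n * c a n)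
        = w n * (F (y + r • (n : E3)) - ∑ a ∈ T', r ^ a * c a n) := by
      rw [mul_sub, Finset.mul_sum]
      congr 1
      exact Finset.sum_congr rfl fun a _ => by ring
    rw [this, norm_mul]
    exact mul_le_one₀ (hw1 n) (norm_nonneg _) h1

lemma finsum_lt_eq {c : ℝ → S2 → ℝ} (T : Finset ℝ)
    (hT : ∀ a, a ∈ T ↔ a ≤ ((0 : ℕ) : ℝ) ∧ c a ≠ 0) (s : ℝ) :
    (∑ᶠ (a : ℝ) (_ : a < -3), s ^ (a + 3) / (a + 3) * ∫ n : S2, c a n ∂dOmega)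
      = ∑ a ∈ T with a < -3, s ^ (a + 3) / (a + 3) * ∫ n : S2, c a n ∂dOmega := by
  refine finsum_mem_eq_sum_of_inter_support_eq (s := {a : ℝ | a < -3}) _ ?_
  ext a
  simp only [Set.mem_inter_iff, Set.mem_ofPred_eq, Function.mem_support, Finset.coe_filter, hT]
  constructor
  · rintro ⟨h1, h2⟩
    refine ⟨⟨⟨?_, fun h0 => h2 (by simp [h0])⟩, h1⟩, h2⟩
    push_cast; linarith
  · rintro ⟨⟨_, h1⟩, h2⟩
    exact ⟨h1, h2⟩

/-- Integer sum split. -/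
lemma int_split (u : ℤ → ℝ) (hu : (Function.support u).Finite) :
    ∑ᶠ m, u m = u (-1) + ∑ᶠ k : ℕ, u (-2 - k) + ∑ᶠ k : ℕ, u k := by
  have i1 : Function.Injective (fun k : ℕ => (k : ℤ)) := fun a b h => by simpa using h
  have i2 : Function.Injective (fun k : ℕ => (-2 - k : ℤ)) := fun a b h => by simpa using h
  have i3 : Function.Injective (fun k : ℕ => (-((k:ℤ) + 1))) := fun a b h => by simpa using h
  have f1 : (Function.support fun k : ℕ => u k).Finite := hu.preimage i1.injOn
  have f2 : (Function.support fun k : ℕ => u (-2 - k)).Finite := hu.preimage i2.injOn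
  have f3 : (Function.support fun k : ℕ => u (-((k:ℤ) + 1))).Finite := hu.preimage i3.injOn
  rw [← tsum_eq_finsum (L := SummationFilter.unconditional _) hu,
    ← tsum_eq_finsum (L := SummationFilter.unconditional _) f1,
    ← tsum_eq_finsum (L := SummationFilter.unconditional _) f2,
    tsum_of_nat_of_neg_add_one (summable_of_hasFiniteSupport f1)
      (summable_of_hasFiniteSupport f3),
    (summable_of_hasFiniteSupport f3).tsum_eq_zero_add]
  have : ∀ k : ℕ, u (-(((k + 1 : ℕ) : ℤ) + 1)) = u (-2 - k) := fun k => by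
    congr 1; push_cast; ring
  simp only [this]
  simp
  ring

lemma sum_bound (T : Finset ℝ) (f : ℝ → ℝ) (N : ℕ) (hT : ∀ a ∈ T, -(N:ℝ) ≤ a) (r : ℝ) (hr : 0 < r)
    (hr1 : r < 1) : |∑ a ∈ T, r ^ a * f a| ≤ r ^ (-(N:ℝ)) * ∑ a ∈ T, |f a| := by
  rw [Finset.mul_sum]
  refine (Finset.abs_sum_le_sum_abs _ _).trans (Finset.sum_le_sum fun a ha => ?_)
  rw [abs_mul, abs_of_nonneg (Real.rpow_nonneg hr.le _)]
  exact mul_le_mul_of_nonneg_right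
    (Real.rpow_le_rpow_of_exponent_ge hr hr1.le (hT a ha)) (abs_nonneg _)

lemma mul_coeff {y : E3} {F G : E3 → ℝ} {f g h : ℝ → S2 → ℝ} (hF : HasSingExpansion y F f)
    (hG : HasSingExpansion y G g) (hH : HasSingExpansion y (fun x => F x * G x) h)
    (hf : IntegerExponents f) (n : S2) :
    h (-2) n = f (-1) n * g (-1) n + ∑ᶠ k : ℕ, f (-2 - (k : ℝ)) n * g (k : ℝ) n
      + ∑ᶠ k : ℕ, g (-2 - (k : ℝ)) n * f (k : ℝ) n := by
  classical
  obtain ⟨a0, ha0⟩ := hF.bddBelow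
  obtain ⟨b0, hb0⟩ := hG.bddBelow
  obtain ⟨N, hN⟩ := exists_nat_ge (|a0| + |b0| + 2)
  have hNa : -(N:ℝ) + 2 ≤ a0 := by
    have := neg_abs_le a0; have := abs_nonneg b0; linarith
  have hNb : -(N:ℝ) + 2 ≤ b0 := by
    have := neg_abs_le b0; have := abs_nonneg a0; linarith
  have hfa : ∀ a, f a ≠ 0 → a0 ≤ a := fun a ha => by
    by_contra hlt; exact ha (ha0 a (not_le.1 hlt))
  have hgb : ∀ a, g a ≠ 0 → b0 ≤ a := fun a ha => by
    by_contra hlt; exact ha (hb0 a (not_le.1 hlt))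
  obtain ⟨Tf, hTf, HF⟩ := exp_finset hF N
  obtain ⟨Tg, hTg, HG⟩ := exp_finset hG N
  obtain ⟨Th, hTh, HH⟩ := exp_finset hH 0
  obtain ⟨δ1, hδ1, HF⟩ := HF 1 one_pos
  obtain ⟨δ2, hδ2, HG⟩ := HG 1 one_pos
  obtain ⟨δ3, hδ3, HH⟩ := HH 1 one_pos
  set AF := ∑ a ∈ Tf, |f a n|
  set AG := ∑ a ∈ Tg, |g a n|
  have hbound : ∀ᶠ s in 𝓝[>] (0 : ℝ),
      |∑ j ∈ Th.disjSum (Tf ×ˢ Tg), s ^ (Sum.elim id (fun p : ℝ × ℝ => p.1 + p.2) j) *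
        (Sum.elim (fun a => h a n) (fun p : ℝ × ℝ => -(f p.1 n * g p.2 n)) j)
          + 0 * Real.log s| ≤ 1 + (AG + 1) + AF := by
    filter_upwards [Ioo_mem_nhdsGT hδ1, Ioo_mem_nhdsGT hδ2, Ioo_mem_nhdsGT hδ3,
      Ioo_mem_nhdsGT one_pos] with r h1 h2 h3 h4
    have hr : 0 < r := h1.1
    have e1 := HF r hr h1.2 n
    have e2 := HG r hr h2.2 n
    have e3 := HH r hr h3.2 n
    have b1 := sum_bound Tf (fun a => f a n) N
      (fun a ha => by linarith [hfa a ((hTf a).1 ha).2]) r hr h4.2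
    have b2 := sum_bound Tg (fun a => g a n) N
      (fun a ha => by linarith [hgb a ((hTg a).1 ha).2]) r hr h4.2
    have hprod : ∑ p ∈ Tf ×ˢ Tg, r ^ (p.1 + p.2) * -(f p.1 n * g p.2 n)
        = -((∑ a ∈ Tf, r ^ a * f a n) * ∑ a ∈ Tg, r ^ a * g a n) := by
      rw [Finset.sum_mul_sum, ← Finset.sum_product', ← Finset.sum_neg_distrib]
      refine Finset.sum_congr rfl fun p _ => ?_
      rw [Real.rpow_add hr]; ring
    rw [Finset.sum_disjSum]
    simp only [Sum.elim_inl, Sum.elim_inr, id, zero_mul, add_zero]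
    rw [hprod]
    simp only [Nat.cast_zero, Real.rpow_zero, mul_one, one_mul] at e1 e2 e3
    set sF := ∑ a ∈ Tf, r ^ a * f a n
    set sG := ∑ a ∈ Tg, r ^ a * g a n
    set sH := ∑ a ∈ Th, r ^ a * h a n
    set x := y + r • (n : E3)
    have hrN : 0 < r ^ (N:ℝ) := Real.rpow_pos_of_pos hr _
    have hrN1 : r ^ (N:ℝ) ≤ 1 := Real.rpow_le_one hr.le h4.2.le (by positivity)
    have hinv : r ^ (N:ℝ) * r ^ (-(N:ℝ)) = 1 := by
      rw [← Real.rpow_add hr]; simp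
    have hG' : |G x| ≤ r ^ (-(N:ℝ)) * AG + r ^ (N:ℝ) := by
      have := abs_sub_abs_le_abs_sub (G x) sG
      linarith
    have k1 : |(F x - sF) * G x| ≤ AG + 1 := by
      rw [abs_mul]
      calc _ ≤ r ^ (N:ℝ) * (r ^ (-(N:ℝ)) * AG + r ^ (N:ℝ)) := by gcongr
        _ = AG + r ^ (N:ℝ) * r ^ (N:ℝ) := by rw [mul_add, ← mul_assoc, hinv, one_mul]
        _ ≤ AG + 1 := by nlinarith
    have k2 : |sF * (G x - sG)| ≤ AF := by
      rw [abs_mul]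
      calc _ ≤ (r ^ (-(N:ℝ)) * AF) * r ^ (N:ℝ) := by gcongr
        _ = AF := by rw [mul_right_comm, mul_comm (r ^ (-(N:ℝ))), hinv, one_mul]
    have : sH + -(sF * sG) = -(F x * G x - sH) + (F x - sF) * G x + sF * (G x - sG) := by ring
    rw [this]
    refine (abs_add_three _ _ _).trans ?_
    rw [abs_neg]
    gcongr
  have key := (asym_indexed _ _ _ 0 _ hbound).2.1 (-2) (by norm_num)
  rw [Finset.sum_filter, Finset.sum_disjSum] at key
  replace key : (∑ x ∈ Th, if x = -2 then h x n else 0)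
      + (∑ x ∈ Tf ×ˢ Tg, if x.1 + x.2 = -2 then -(f x.1 n * g x.2 n) else 0) = 0 := by
    convert key <;> rfl
  rw [Finset.sum_ite_eq'] at key
  have k1 : (if (-2:ℝ) ∈ Th then h (-2) n else 0) = h (-2) n := by
    split_ifs with hm
    · rfl
    · rw [hTh] at hm
      have : h (-2) = 0 := by
        by_contra h0; exact hm ⟨by norm_num, h0⟩
      simp [this]
  rw [k1, Finset.sum_product] at key
  have k2 : ∑ a ∈ Tf, ∑ b ∈ Tg, (if a + b = -2 then -(f a n * g b n) else 0)
      = - ∑ a ∈ Tf, f a n * g (-2 - a) n := by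
    rw [← Finset.sum_neg_distrib]
    refine Finset.sum_congr rfl fun a ha => ?_
    have : ∀ b, (a + b = -2) ↔ (b = -2 - a) := fun b => by constructor <;> intro h <;> linarith
    simp only [this, Finset.sum_ite_eq']
    split_ifs with hm
    · rfl
    · rw [hTg] at hm
      have : g (-2 - a) = 0 := by
        by_contra h0
        exact hm ⟨by linarith [hfa a ((hTf a).1 ha).2], h0⟩
      simp [this]
  rw [k2] at key
  have k3 : ∑ a ∈ Tf, f a n * g (-2 - a) n = ∑ᶠ a : ℝ, f a n * g (-2 - a) n := by
    symm
    refine finsum_eq_sum_of_support_subset _ ?_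
    intro a ha
    have h1 : f a ≠ 0 := fun h0 => ha (by simp [h0])
    have h2 : g (-2 - a) ≠ 0 := fun h0 => ha (by simp [h0])
    exact (hTf a).2 ⟨by linarith [hgb _ h2], h1⟩
  have hinj : Function.Injective (fun m : ℤ => (m : ℝ)) := Int.cast_injective
  have k4 : ∑ᶠ a : ℝ, f a n * g (-2 - a) n = ∑ᶠ m : ℤ, f (m : ℝ) n * g (-2 - (m : ℝ)) n := by
    rw [← finsum_mem_range (f := fun a : ℝ => f a n * g (-2 - a) n) hinj, ← finsum_mem_univ]
    refine finsum_mem_inter_support_eq' _ _ _ fun a ha => ?_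
    have h1 : f a ≠ 0 := fun h0 => ha (by simp [h0])
    obtain ⟨m, hm⟩ := hf a h1
    simp [hm]
  have hfin : (Function.support fun m : ℤ => f (m : ℝ) n * g (-2 - (m : ℝ)) n).Finite := by
    have : (Function.support fun a : ℝ => f a n * g (-2 - a) n).Finite := by
      refine Tf.finite_toSet.subset ?_
      intro a ha
      have h1 : f a ≠ 0 := fun h0 => ha (by simp [h0])
      have h2 : g (-2 - a) ≠ 0 := fun h0 => ha (by simp [h0])
      exact (hTf a).2 ⟨by linarith [hgb _ h2], h1⟩
    exact this.preimage hinj.injOn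
  have k5 := int_split _ hfin
  have k6 : h (-2) n = ∑ᶠ m : ℤ, f (m : ℝ) n * g (-2 - (m : ℝ)) n := by
    rw [← k4, ← k3]; linarith
  rw [k6, k5]
  congr 1
  · congr 1
    · norm_num
    · refine finsum_congr fun k => ?_
      push_cast
      congr 2
      ring_nf
  · refine finsum_congr fun k => ?_
    push_cast
    ring

lemma coord_cont (i : Fin 3) : Continuous fun n : S2 => (n : E3) i := by fun_prop

lemma finsum_cont {f g : ℝ → S2 → ℝ} {y : E3} {F G : E3 → ℝ} (hF : HasSingExpansion y F f)
    (hG : HasSingExpansion y G g) :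
    Continuous fun n : S2 => ∑ᶠ k : ℕ, f (-2 - (k : ℝ)) n * g (k : ℝ) n := by
  obtain ⟨a0, ha0⟩ := hF.bddBelow
  obtain ⟨K, hK⟩ := exists_nat_ge (-2 - a0)
  have : (fun n : S2 => ∑ᶠ k : ℕ, f (-2 - (k : ℝ)) n * g (k : ℝ) n)
      = fun n => ∑ k ∈ Finset.range (K + 1), f (-2 - (k : ℝ)) n * g (k : ℝ) n := by
    ext n
    refine finsum_eq_sum_of_support_subset _ ?_
    intro k hk
    simp only [Finset.coe_range, Set.mem_Iio]
    by_contra hlt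
    push Not at hlt
    refine hk ?_
    have : f (-2 - (k : ℝ)) = 0 := ha0 _ (by
      have : ((K + 1 : ℕ) : ℝ) ≤ k := by exact_mod_cast hlt
      push_cast at this
      linarith)
    simp [this]
  rw [this]
  exact continuous_finsetSum _ fun k _ =>
    (smooth_cont (hF.smooth_coeffs _)).mul (smooth_cont (hG.smooth_coeffs _))

lemma dpart_one {y : E3} {F G : E3 → ℝ} {f g h : ℝ → S2 → ℝ} (hF : HasSingExpansion y F f)
    (hG : HasSingExpansion y G g) (hH : HasSingExpansion y (fun x => F x * G x) h)
    (hf : IntegerExponents f) (i : Fin 3) :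
    (∫ n : S2, (n : E3) i * ((1 / 2) * f (-1) n * g (-1) n
        + ∑ᶠ k : ℕ, f (-2 - (k : ℝ)) n * g (k : ℝ) n) ∂dOmega)
    + (∫ n : S2, (n : E3) i * ((1 / 2) * g (-1) n * f (-1) n
        + ∑ᶠ k : ℕ, g (-2 - (k : ℝ)) n * f (k : ℝ) n) ∂dOmega)
    = ∫ n : S2, (n : E3) i * h (-2) n ∂dOmega := by
  have cF := smooth_cont (hF.smooth_coeffs (-1))
  have cG := smooth_cont (hG.smooth_coeffs (-1))
  rw [← integral_add]
  · refine integral_congr_ae (Eventually.of_forall fun n => ?_)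
    simp only [mul_coeff hF hG hH hf n]
    ring
  · exact cont_int ((coord_cont i).mul
      (((continuous_const.mul cF).mul cG).add (finsum_cont hF hG)))
  · exact cont_int ((coord_cont i).mul
      (((continuous_const.mul cG).mul cF).add (finsum_cont hG hF)))

lemma polar_full (f : E3 → ℝ) (hf : Integrable f) (y : E3) :
    ∫ x, f x = ∫ r in Set.Ioi (0:ℝ), r ^ 2 * ∫ n : S2, f (y + r • (n : E3)) ∂dOmega := by
  have hd : Module.finrank ℝ E3 - 1 = 2 := by simp
  set g : E3 → ℝ := fun x => f (y + x) with hg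
  have hgi : Integrable g := hf.comp_add_left y
  have e0 : ∫ x, f x = ∫ x, g x := (integral_add_left_eq_self f y).symm
  have mp := (volume : Measure E3).measurePreserving_homeomorphUnitSphereProd
  rw [hd] at mp
  have e1 : ∫ x, g x = ∫ x : ({(0 : E3)}ᶜ : Set E3), g x ∂((volume : Measure E3).comap (↑)) := by
    rw [integral_subtype_comap (measurableSet_singleton _).compl g, restrict_compl_singleton]
  have hcomp : ∀ x : ({(0 : E3)}ᶜ : Set E3),
      g x = (fun p : S2 × Set.Ioi (0:ℝ) => g ((p.2 : ℝ) • (p.1 : E3)))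
        (homeomorphUnitSphereProd E3 x) := by
    intro x
    have := (homeomorphUnitSphereProd E3).symm_apply_apply x
    conv_lhs => rw [← this]
    rw [homeomorphUnitSphereProd_symm_apply_coe]
  have hi1 : Integrable (fun x : ({(0 : E3)}ᶜ : Set E3) => g x) ((volume : Measure E3).comap (↑)) := by
    have := hgi.integrableOn (s := ({0}ᶜ : Set E3))
    exact (integrableOn_iff_comap_subtypeVal (measurableSet_singleton _).compl).1 this
  have hi2 : Integrable (fun p : S2 × Set.Ioi (0:ℝ) => g ((p.2 : ℝ) • (p.1 : E3)))
      ((volume : Measure E3).toSphere.prod (Measure.volumeIoiPow 2)) := by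
    rw [← mp.integrable_comp_emb (Homeomorph.measurableEmbedding _)]
    refine hi1.congr (Eventually.of_forall fun x => ?_)
    exact hcomp x
  have e2 := mp.integral_comp (Homeomorph.measurableEmbedding _)
    (fun p : S2 × Set.Ioi (0:ℝ) => g ((p.2 : ℝ) • (p.1 : E3)))
  rw [e0, e1]
  simp_rw [hcomp]
  rw [e2, integral_prod_symm _ hi2]
  simp only [Measure.volumeIoiPow, ENNReal.ofReal]
  rw [integral_withDensity_eq_integral_smul (by fun_prop),
    integral_subtype_comap measurableSet_Ioi fun r : ℝ => Real.toNNReal (r ^ 2) •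
      ∫ n : S2, g (r • (n : E3)) ∂(volume : Measure E3).toSphere]
  refine setIntegral_congr_fun measurableSet_Ioi fun r hr => ?_
  simp only [NNReal.smul_def, Real.coe_toNNReal _ (sq_nonneg r), smul_eq_mul]
  rfl

lemma norm_S2 (n : S2) : ‖(n : E3)‖ = 1 := by simpa using n.2

lemma dist_polar (y : E3) (r : ℝ) (hr : 0 < r) (n : S2) : dist (y + r • (n : E3)) y = r := by
  simp [norm_smul, abs_of_pos hr, norm_S2]

lemma polar_set (f : E3 → ℝ) (y : E3) (A : Set ℝ) (hA : MeasurableSet A) (hA0 : A ⊆ Set.Ioi 0)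
    (hf : IntegrableOn f {x | dist x y ∈ A}) :
    ∫ x in {x | dist x y ∈ A}, f x
      = ∫ r in A, r ^ 2 * ∫ n : S2, f (y + r • (n : E3)) ∂dOmega := by
  have hm : MeasurableSet {x : E3 | dist x y ∈ A} :=
    (measurable_id.dist measurable_const) hA
  rw [← integral_indicator hm, polar_full _ (hf.integrable_indicator hm) y,
    ← integral_indicator hA, ← integral_indicator measurableSet_Ioi]
  congr 1
  ext r
  by_cases hr : r ∈ A
  · have h0 : r ∈ Set.Ioi (0:ℝ) := hA0 hr
    rw [Set.indicator_of_mem h0, Set.indicator_of_mem hr]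
    congr 2
    ext n
    rw [Set.indicator_of_mem]
    simpa only [Set.mem_ofPred_eq, dist_polar y r h0 n] using hr
  · rw [Set.indicator_of_notMem hr]
    by_cases h0 : r ∈ Set.Ioi (0:ℝ)
    · rw [Set.indicator_of_mem h0]
      have : ∀ n : S2, {x : E3 | dist x y ∈ A}.indicator f (y + r • (n : E3)) = 0 := by
        intro n
        rw [Set.indicator_of_notMem]
        simpa only [Set.mem_ofPred_eq, dist_polar y r h0 n] using hr
      simp [this]
    · rw [Set.indicator_of_notMem h0]

lemma int_pder_zero (i : Fin 3) (K : E3 → ℝ) (hK : ContDiff ℝ 1 K)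
    (hIntg : Integrable (pder i K))
    (hdec : Tendsto (fun x : E3 => ‖x‖ ^ 2 * K x) (cocompact E3) (𝓝 0)) :
    ∫ x, pder i K x = 0 := by
  let b : ContDiffBump (0 : E3) := ⟨1, 2, one_pos, one_lt_two⟩
  have hb : ContDiff ℝ 1 (b : E3 → ℝ) := b.contDiff
  let R : ℕ → ℝ := fun m => (m : ℝ) + 1
  have hR : ∀ m, 0 < R m := fun m => by positivity
  let χ : ℕ → E3 → ℝ := fun m x => b ((R m)⁻¹ • x)
  have hχd : ∀ m, ContDiff ℝ 1 (χ m) := fun m => hb.comp (contDiff_const_smul _)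
  have hχz : ∀ m x, 2 * R m ≤ ‖x‖ → χ m x = 0 := by
    intro m x hx
    apply b.zero_of_le_dist
    rw [dist_zero_right, norm_smul, norm_inv, Real.norm_of_nonneg (hR m).le]
    change 2 ≤ _
    rw [inv_mul_eq_div, le_div_iff₀ (hR m)]; exact hx
  have hχs : ∀ m, HasCompactSupport (χ m) := fun m => by
    refine HasCompactSupport.intro (isCompact_closedBall (0:E3) (2 * R m)) fun x hx => ?_
    simp at hx
    exact hχz m x hx.le
  have hd : ∀ m x, fderiv ℝ (χ m) x (EuclideanSpace.single i 1)
      = (R m)⁻¹ * fderiv ℝ b ((R m)⁻¹ • x) (EuclideanSpace.single i 1) := by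
    intro m x
    change fderiv ℝ (fun x => b ((R m)⁻¹ • x)) x _ = _
    rw [fderiv_comp_smul]; simp
  have hcK : Continuous (fun x => fderiv ℝ K x (EuclideanSpace.single i 1)) :=
    (hK.continuous_fderiv one_ne_zero).clm_apply continuous_const
  have hcχ : ∀ m, Continuous (fun x => fderiv ℝ (χ m) x (EuclideanSpace.single i 1)) := fun m =>
    ((hχd m).continuous_fderiv one_ne_zero).clm_apply continuous_const
  have hsχ : ∀ m, HasCompactSupport (fun x => fderiv ℝ (χ m) x (EuclideanSpace.single i 1)) :=
    fun m => (hχs m).fderiv_apply ℝ _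
  have ibp : ∀ m, ∫ x, χ m x * fderiv ℝ K x (EuclideanSpace.single i 1)
      = - ∫ x, fderiv ℝ (χ m) x (EuclideanSpace.single i 1) * K x := by
    intro m
    refine integral_mul_fderiv_eq_neg_fderiv_mul_of_integrable ?_ ?_ ?_ ?_ ?_
    · exact ((hcχ m).mul hK.continuous).integrable_of_hasCompactSupport (hsχ m).mul_right
    · exact ((hχd m).continuous.mul hcK).integrable_of_hasCompactSupport (hχs m).mul_right
    · exact ((hχd m).continuous.mul hK.continuous).integrable_of_hasCompactSupport
        (hχs m).mul_right
    · exact fun x _ => ((hχd m).differentiable one_ne_zero) x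
    · exact fun x _ => (hK.differentiable one_ne_zero) x
  have lim1 : Tendsto (fun m => ∫ x, χ m x * fderiv ℝ K x (EuclideanSpace.single i 1)) atTop
      (𝓝 (∫ x, pder i K x)) := by
    refine tendsto_integral_of_dominated_convergence (fun x => ‖pder i K x‖) ?_ hIntg.norm ?_ ?_
    · exact fun m => ((hχd m).continuous.mul hcK).aestronglyMeasurable
    · intro m
      refine Eventually.of_forall fun x => ?_
      rw [norm_mul]
      refine mul_le_of_le_one_left (norm_nonneg _) ?_
      rw [Real.norm_of_nonneg (b.nonneg' _)]
      exact b.le_one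
    · refine Eventually.of_forall fun x => ?_
      refine tendsto_const_nhds.congr' ?_
      obtain ⟨M, hM⟩ := exists_nat_ge ‖x‖
      filter_upwards [eventually_ge_atTop M] with m hm
      have : χ m x = 1 := by
        apply b.one_of_mem_closedBall
        rw [mem_closedBall_zero_iff, norm_smul, norm_inv, Real.norm_of_nonneg (hR m).le]
        change _ ≤ (1:ℝ)
        rw [inv_mul_eq_div, div_le_one (hR m)]
        have : (M:ℝ) ≤ m := by exact_mod_cast hm
        simp only [R]; linarith
      rw [this, one_mul]; rfl
  obtain ⟨C, hC⟩ := ((b.hasCompactSupport).fderiv_apply ℝ (EuclideanSpace.single i (1:ℝ))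
    ).exists_bound_of_continuous
    ((hb.continuous_fderiv one_ne_zero).clm_apply continuous_const)
  have hC0 : 0 ≤ C := (norm_nonneg _).trans (hC 0)
  have hbz : ∀ x : E3, ‖x‖ < 1 → fderiv ℝ b x = 0 := by
    intro x hx
    have : (b : E3 → ℝ) =ᶠ[𝓝 x] fun _ => (1:ℝ) := by
      filter_upwards [Metric.isOpen_ball.mem_nhds (mem_ball_zero_iff.2 hx)] with z hz
      exact b.one_of_mem_closedBall (Metric.ball_subset_closedBall hz)
    rw [this.fderiv_eq]; simp
  have hbz2 : ∀ x : E3, 2 < ‖x‖ → fderiv ℝ b x = 0 := by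
    intro x hx
    have : (b : E3 → ℝ) =ᶠ[𝓝 x] fun _ => (0:ℝ) := by
      filter_upwards [(isOpen_lt continuous_const continuous_norm).mem_nhds hx] with z hz
      exact b.zero_of_le_dist (by simpa using (le_of_lt hz : (2:ℝ) ≤ ‖z‖))
    rw [this.fderiv_eq]; simp
  set V := (volume : Measure E3).real (Metric.ball 0 1)
  have lim2 : Tendsto (fun m => ∫ x, fderiv ℝ (χ m) x (EuclideanSpace.single i 1) * K x) atTop
      (𝓝 0) := by
    rw [Metric.tendsto_atTop]
    intro ε hε
    set δ := ε / (8 * C * V + 1)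
    have hVC : 0 ≤ 8 * C * V := by positivity
    have hδ : 0 < δ := by positivity
    have h1 := (Metric.tendsto_nhds.1 hdec) δ hδ
    obtain ⟨ρ, hρ⟩ : ∃ ρ : ℝ, ∀ x : E3, ρ < ‖x‖ → dist (‖x‖ ^ 2 * K x) 0 < δ := by
      rw [← Metric.cobounded_eq_cocompact, ← comap_norm_atTop] at h1
      rw [eventually_comap] at h1
      obtain ⟨ρ, hρ⟩ := (eventually_atTop.1 h1)
      exact ⟨ρ, fun x hx => hρ _ hx.le x rfl⟩
    obtain ⟨M, hM⟩ := exists_nat_ge ρ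
    refine ⟨M, fun m hm => ?_⟩
    have hRρ : ρ < R m := by
      have : (M:ℝ) ≤ m := by exact_mod_cast hm
      simp only [R]; linarith
    have hpt : ∀ x : E3, ‖fderiv ℝ (χ m) x (EuclideanSpace.single i 1) * K x‖
        ≤ C * δ / R m ^ 3 := by
      intro x
      rw [hd]
      rcases lt_or_ge ‖x‖ (R m) with hlt | hge
      · rw [hbz]
        · simp; have := hR m; positivity
        · rw [norm_smul, norm_inv, Real.norm_of_nonneg (hR m).le, inv_mul_eq_div,
            div_lt_one (hR m)]
          exact hlt
      · have h2 := hρ x (hRρ.trans_le hge)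
        rw [dist_zero_right, norm_mul, norm_pow, norm_norm] at h2
        have h3 : ‖K x‖ ≤ δ / R m ^ 2 := by
          rw [le_div_iff₀ (by have := hR m; positivity), mul_comm]
          refine le_trans ?_ h2.le
          have := (hR m).le
          gcongr
        rw [norm_mul, norm_mul, norm_inv, Real.norm_of_nonneg (hR m).le]
        calc (R m)⁻¹ * ‖fderiv ℝ b ((R m)⁻¹ • x) (EuclideanSpace.single i 1)‖ * ‖K x‖
            ≤ (R m)⁻¹ * C * (δ / R m ^ 2) := by
              have := (hR m).le
              gcongr
              exact hC _
          _ = _ := by have := (hR m).ne'; field_simp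
    have hset : ∫ x, fderiv ℝ (χ m) x (EuclideanSpace.single i 1) * K x
        = ∫ x in Metric.closedBall 0 (2 * R m),
          fderiv ℝ (χ m) x (EuclideanSpace.single i 1) * K x := by
      symm
      refine setIntegral_eq_integral_of_forall_compl_eq_zero fun x hx => ?_
      rw [hd, hbz2]
      · simp
      · simp only [mem_closedBall_zero_iff, not_le] at hx
        rw [norm_smul, norm_inv, Real.norm_of_nonneg (hR m).le, inv_mul_eq_div,
            lt_div_iff₀ (hR m)]
        exact hx
    rw [dist_zero_right, hset]
    refine (norm_setIntegral_le_of_norm_le_const (C := C * δ / R m ^ 3)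
      measure_closedBall_lt_top (fun x _ => hpt x)).trans_lt ?_
    rw [Measure.addHaar_real_closedBall _ _ (by have := hR m; positivity)]
    have : C * δ / R m ^ 3 * ((2 * R m) ^ Module.finrank ℝ E3 * V) = (8 * C * V) * δ := by
      have := (hR m).ne'
      simp only [finrank_euclideanSpace, Fintype.card_fin]
      field_simp; ring
    rw [this]
    simp only [δ]
    rw [mul_div_assoc', div_lt_iff₀ (by positivity)]
    nlinarith
  have := tendsto_nhds_unique lim1 (by simpa [ibp] using lim2.neg)
  exact this

def eta (y : E3) (s ε : ℝ) (x : E3) : ℝ := smoothTransition ((‖x - y‖ ^ 2 - s ^ 2) / ε)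

def flux (i : Fin 3) (y : E3) (H : E3 → ℝ) (r : ℝ) : ℝ :=
  r ^ 2 * ∫ n : S2, (n : E3) i * H (y + r • (n : E3)) ∂dOmega

lemma eta_contDiff (y : E3) (s ε : ℝ) : ContDiff ℝ (⊤ : ℕ∞) (eta y s ε) := by
  unfold eta
  refine smoothTransition.contDiff.comp ?_
  have : ContDiff ℝ (⊤ : ℕ∞) (fun x : E3 => ‖x - y‖ ^ 2) :=
    (contDiff_id.sub contDiff_const).norm_sq ℝ
  exact (this.sub contDiff_const).div_const _

lemma eta_zero (y : E3) (s ε : ℝ) (hε : 0 < ε) (x : E3) (h : dist x y ≤ s) : eta y s ε x = 0 := by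
  apply smoothTransition.zero_of_nonpos
  apply div_nonpos_of_nonpos_of_nonneg _ hε.le
  rw [dist_eq_norm] at h
  nlinarith [norm_nonneg (x - y)]

lemma eta_one (y : E3) (s ε : ℝ) (hε : 0 < ε) (x : E3) (h : s ^ 2 + ε ≤ dist x y ^ 2) :
    eta y s ε x = 1 := by
  apply smoothTransition.one_of_one_le
  rw [le_div_iff₀ hε]
  rw [dist_eq_norm] at h
  linarith

lemma eta_nonneg (y : E3) (s ε : ℝ) (x : E3) : 0 ≤ eta y s ε x := smoothTransition.nonneg _
lemma eta_le_one (y : E3) (s ε : ℝ) (x : E3) : eta y s ε x ≤ 1 := smoothTransition.le_one _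

lemma dtau_zero (u : ℝ) (h : u ≤ 0 ∨ 1 ≤ u) : deriv smoothTransition u = 0 := by
  rcases h with h | h
  · apply IsLocalMin.deriv_eq_zero
    refine Eventually.of_forall fun v => ?_
    rw [smoothTransition.zero_of_nonpos h]; exact smoothTransition.nonneg _
  · apply IsLocalMax.deriv_eq_zero
    refine Eventually.of_forall fun v => ?_
    rw [smoothTransition.one_of_one_le h]; exact smoothTransition.le_one _

lemma tau_diff (u : ℝ) : HasDerivAt smoothTransition (deriv smoothTransition u) u :=
  ((smoothTransition.contDiff (n := 1)).differentiable one_ne_zero u).hasDerivAt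

lemma dtau_cont : Continuous (deriv smoothTransition) :=
  (smoothTransition.contDiff (n := 1)).continuous_deriv le_rfl

lemma pder_eta (i : Fin 3) (y : E3) (s ε : ℝ) (x : E3) :
    pder i (eta y s ε) x
      = deriv smoothTransition ((‖x - y‖ ^ 2 - s ^ 2) / ε) * (2 * (x - y) i / ε) := by
  have h1 : HasFDerivAt (fun x : E3 => ‖x - y‖ ^ 2)
      (2 • (innerSL ℝ (x - y)).comp (ContinuousLinearMap.id ℝ E3)) x :=
    ((hasFDerivAt_id x).sub_const y).norm_sq
  have h2 : HasFDerivAt (fun x : E3 => (‖x - y‖ ^ 2 - s ^ 2) / ε) _ x := 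
    (h1.sub_const (s ^ 2)).mul_const ε⁻¹
  have h3 := (tau_diff ((‖x - y‖ ^ 2 - s ^ 2) / ε)).comp_hasFDerivAt x h2
  unfold pder
  have h4 : HasFDerivAt (eta y s ε) _ x := h3
  rw [h4.fderiv]
  simp [EuclideanSpace.inner_single_right, div_eq_mul_inv]
  left
  ring

lemma flux_cont (i : Fin 3) (y : E3) (H : E3 → ℝ) (s ρ : ℝ) (hs : 0 < s)
    (hH : ContinuousOn H {x | dist x y ∈ Set.Icc s ρ}) :
    ContinuousOn (flux i y H) (Set.Icc s ρ) := by
  unfold flux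
  refine (continuous_pow 2).continuousOn.mul ?_
  rw [continuousOn_iff_continuous_domRestrict]
  have : Continuous (fun r : Set.Icc s ρ =>
      ∫ n in (Set.univ : Set S2), (n : E3) i * H (y + (r:ℝ) • (n : E3)) ∂dOmega) := by
    refine continuous_parametric_integral_of_continuous (X := Set.Icc s ρ) ?_ isCompact_univ
    refine Continuous.mul ((coord_cont i).comp continuous_snd) ?_
    refine hH.comp_continuous (by fun_prop) fun p => ?_
    simp only [Set.mem_ofPred_eq]
    rw [dist_polar y _ (hs.trans_le p.1.2.1)]
    exact p.1.2
  simp only [Measure.restrict_univ] at this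
  exact this

lemma shell_compact (y : E3) (s ρ : ℝ) : IsCompact {x : E3 | dist x y ∈ Set.Icc s ρ} := by
  refine (isCompact_closedBall y ρ).of_isClosed_subset
    (isClosed_Icc.preimage (by fun_prop)) fun x hx => hx.2

lemma layer (i : Fin 3) (y : E3) (H : E3 → ℝ) (s ρ : ℝ) (hs : 0 < s) (hρ : s < ρ)
    (hH : ContinuousOn H {x | dist x y ∈ Set.Icc s ρ}) :
    Tendsto (fun ε => ∫ x, pder i (eta y s ε) x * H x) (𝓝[>] 0) (𝓝 (flux i y H s)) := by
  have hpc : ∀ ε, Continuous (pder i (eta y s ε)) := fun ε =>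
    ((eta_contDiff y s ε).continuous_fderiv (by simp)).clm_apply continuous_const
  set w : ℝ → ℝ → ℝ := fun ε r => deriv smoothTransition ((r ^ 2 - s ^ 2) / ε) * (2 * r / ε) with hw
  have hwc : ∀ ε, Continuous (w ε) := fun ε =>
    (dtau_cont.comp (by fun_prop)).mul (by fun_prop)
  have hfc := flux_cont i y H s ρ hs hH
  have hw0 : ∀ ε > 0, ∀ r, s ≤ r → 0 ≤ w ε r := by
    intro ε hε r hr
    have : 0 ≤ r := hs.le.trans hr
    exact mul_nonneg (smoothTransition.monotone.deriv_nonneg) (by positivity)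
  have hwz : ∀ ε > 0, ∀ r, s ^ 2 + ε ≤ r ^ 2 → w ε r = 0 := by
    intro ε hε r hr
    simp only [hw]
    rw [dtau_zero _ (Or.inr _), zero_mul]
    rw [le_div_iff₀ hε]; linarith
  have e1 : ∀ ε > 0, s ^ 2 + ε ≤ ρ ^ 2 → ∫ x, pder i (eta y s ε) x * H x
      = ∫ r in s..ρ, w ε r * flux i y H r := by
    intro ε hε hερ
    have a1 : ∫ x, pder i (eta y s ε) x * H x
        = ∫ x in {x | dist x y ∈ Set.Ioc s ρ}, pder i (eta y s ε) x * H x := by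
      symm
      refine setIntegral_eq_integral_of_forall_compl_eq_zero fun x hx => ?_
      rw [pder_eta, dtau_zero, zero_mul, zero_mul]
      simp only [Set.mem_ofPred_eq, Set.mem_Ioc, not_and_or, not_lt, not_le, dist_eq_norm] at hx
      rcases hx with hx | hx
      · left
        apply div_nonpos_of_nonpos_of_nonneg _ hε.le
        nlinarith [norm_nonneg (x - y)]
      · right
        rw [le_div_iff₀ hε]
        nlinarith [norm_nonneg (x - y)]
    rw [a1, polar_set _ y _ measurableSet_Ioc (fun r hr => hs.trans hr.1),
      intervalIntegral.integral_of_le hρ.le]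
    · refine setIntegral_congr_fun measurableSet_Ioc fun r hr => ?_
      have hr0 : 0 < r := hs.trans hr.1
      simp only [flux]
      have : ∀ n : S2, pder i (eta y s ε) (y + r • (n : E3)) * H (y + r • (n : E3))
          = w ε r * ((n : E3) i * H (y + r • (n : E3))) := by
        intro n
        rw [pder_eta]
        simp only [add_sub_cancel_left, norm_smul, norm_S2, mul_one, Real.norm_of_nonneg hr0.le, hw,
          PiLp.smul_apply, smul_eq_mul]
        ring
      simp_rw [this]
      rw [integral_const_mul]; ring
    · have : ContinuousOn (fun x => pder i (eta y s ε) x * H x) {x | dist x y ∈ Set.Icc s ρ} :=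
        (hpc ε).continuousOn.mul hH
      exact (this.integrableOn_compact (shell_compact y s ρ)).mono_set
        fun x hx => ⟨hx.1.le, hx.2⟩
  have e2 : ∀ ε > 0, s ^ 2 + ε ≤ ρ ^ 2 → ∫ r in s..ρ, w ε r = 1 := by
    intro ε hε hερ
    have : ∀ r ∈ Set.uIcc s ρ, HasDerivAt (fun r => smoothTransition ((r ^ 2 - s ^ 2) / ε)) (w ε r) r := by
      intro r _
      have h1 : HasDerivAt (fun r : ℝ => (r ^ 2 - s ^ 2) / ε) (2 * r / ε) r := by
        have := (((hasDerivAt_pow 2 r).sub_const (s ^ 2)).div_const ε)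
        simpa using this
      exact (tau_diff _).comp r h1
    rw [intervalIntegral.integral_eq_sub_of_hasDerivAt this ((hwc ε).intervalIntegrable _ _)]
    rw [smoothTransition.one_of_one_le, smoothTransition.zero_of_nonpos]
    · simp
    · simp
    · rw [le_div_iff₀ hε]; linarith
  rw [Metric.tendsto_nhds]
  intro δ hδ
  have hcs : ∀ᶠ r in 𝓝[Set.Icc s ρ] s, |flux i y H r - flux i y H s| < δ / 2 := by
    have := (hfc s ⟨le_rfl, hρ.le⟩)
    have := (Metric.tendsto_nhds.1 this) (δ / 2) (by positivity)
    simpa [Real.dist_eq] using this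
  rw [eventually_nhdsWithin_iff, Metric.eventually_nhds_iff] at hcs
  obtain ⟨γ, hγ, hγ2⟩ := hcs
  have hsmall : ∀ᶠ ε in 𝓝[>] (0:ℝ), s ^ 2 + ε ≤ ρ ^ 2 ∧ s ^ 2 + ε ≤ (s + γ / 2) ^ 2 := by
    refine nhdsWithin_le_nhds ?_
    have a1 : ∀ᶠ ε in 𝓝 (0:ℝ), ε < ρ ^ 2 - s ^ 2 := eventually_lt_nhds (by nlinarith)
    have a2 : ∀ᶠ ε in 𝓝 (0:ℝ), ε < (s + γ / 2) ^ 2 - s ^ 2 := eventually_lt_nhds (by nlinarith)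
    filter_upwards [a1, a2] with ε h1 h2
    constructor <;> linarith
  filter_upwards [hsmall, self_mem_nhdsWithin] with ε ⟨h1, h2⟩ hε
  have hε : 0 < ε := hε
  rw [e1 ε hε h1, Real.dist_eq]
  have hi1 : IntervalIntegrable (fun r => w ε r * flux i y H r) volume s ρ := by
    apply ContinuousOn.intervalIntegrable
    rw [Set.uIcc_of_le hρ.le]
    exact (hwc ε).continuousOn.mul hfc
  have hi2 : IntervalIntegrable (fun r => w ε r * flux i y H s) volume s ρ :=
    ((hwc ε).mul continuous_const).intervalIntegrable _ _
  have : (∫ r in s..ρ, w ε r * flux i y H r) - flux i y H s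
      = ∫ r in s..ρ, w ε r * (flux i y H r - flux i y H s) := by
    simp_rw [mul_sub]
    rw [intervalIntegral.integral_sub hi1 hi2, intervalIntegral.integral_mul_const, e2 ε hε h1, one_mul]
  rw [this]
  have hb : ‖∫ r in s..ρ, w ε r * (flux i y H r - flux i y H s)‖ ≤ ∫ r in s..ρ, w ε r * (δ / 2) := by
    refine intervalIntegral.norm_integral_le_of_norm_le hρ.le ?_
      (((hwc ε).mul continuous_const).intervalIntegrable _ _)
    refine Eventually.of_forall fun r hr => ?_
    rcases le_or_gt (s + γ / 2) r with hr2 | hr2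
    · rw [hwz ε hε r]
      · simp
      · refine h2.trans ?_
        have : 0 ≤ s + γ / 2 := by positivity
        nlinarith
    · rw [norm_mul, Real.norm_of_nonneg (hw0 ε hε r hr.1.le), Real.norm_eq_abs]
      refine mul_le_mul_of_nonneg_left ?_ (hw0 ε hε r hr.1.le)
      refine (hγ2 ?_ ⟨hr.1.le, hr.2⟩).le
      rw [Real.dist_eq, abs_of_pos (by linarith [hr.1])]; linarith
  rw [intervalIntegral.integral_mul_const, e2 ε hε h1, one_mul] at hb
  rw [← Real.norm_eq_abs]
  linarith

lemma pder_eta_cont (i : Fin 3) (y : E3) (s ε : ℝ) : Continuous (pder i (eta y s ε)) :=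
  ((eta_contDiff y s ε).continuous_fderiv (by simp)).clm_apply continuous_const

lemma pder_eta_zero (i : Fin 3) (y : E3) (s ε : ℝ) (hε : 0 < ε) (x : E3)
    (h : dist x y ≤ s ∨ s ^ 2 + ε ≤ dist x y ^ 2) : pder i (eta y s ε) x = 0 := by
  rw [pder_eta, dtau_zero, zero_mul]
  simp only [dist_eq_norm] at h
  rcases h with h | h
  · left
    apply div_nonpos_of_nonpos_of_nonneg _ hε.le
    nlinarith [norm_nonneg (x - y)]
  · right
    rw [le_div_iff₀ hε]
    linarith

lemma layer_integrable (i : Fin 3) (y : E3) (H : E3 → ℝ) (s ρ ε : ℝ) (hρ : 0 < ρ)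
    (hε : 0 < ε) (hερ : s ^ 2 + ε ≤ ρ ^ 2)
    (hH : ContinuousOn H {x | dist x y ∈ Set.Icc s ρ}) :
    Integrable (fun x => pder i (eta y s ε) x * H x) := by
  have h1 : ContinuousOn (fun x => pder i (eta y s ε) x * H x) {x | dist x y ∈ Set.Icc s ρ} :=
    (pder_eta_cont i y s ε).continuousOn.mul hH
  refine (integrableOn_iff_integrable_of_support_subset ?_).1
    (h1.integrableOn_compact (shell_compact y s ρ))
  intro x hx
  by_contra hc
  apply hx
  simp only [Set.mem_ofPred_eq, Set.mem_Icc, not_and_or, not_le] at hc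
  simp only []
  rw [pder_eta_zero i y s ε hε x, zero_mul]
  rcases hc with hc | hc
  · exact Or.inl hc.le
  · right
    nlinarith

lemma div_ext (i : Fin 3) (y1 y2 : E3) (s t : ℝ) (hs : 0 < s) (ht : 0 < t)
    (hst : s + t < dist y1 y2) (H H' : E3 → ℝ)
    (hH : ContDiffOn ℝ (⊤ : ℕ∞) H ({y1, y2}ᶜ : Set E3))
    (hH' : ∀ x ∈ ({y1, y2}ᶜ : Set E3), pder i H x = H' x)
    (hIntg : IntegrableOn H' (Metric.closedBall y1 s ∪ Metric.closedBall y2 t)ᶜ)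
    (hdec : Tendsto (fun x : E3 => ‖x‖ ^ 2 * H x) (cocompact E3) (𝓝 0)) :
    ∫ x in (Metric.closedBall y1 s ∪ Metric.closedBall y2 t)ᶜ, H' x
      = - flux i y1 H s - flux i y2 H t := by
  set d := dist y1 y2 with hd
  set X : Set E3 := (Metric.closedBall y1 s ∪ Metric.closedBall y2 t)ᶜ with hX
  have hXm : MeasurableSet X :=
    (Metric.isClosed_closedBall.union Metric.isClosed_closedBall).measurableSet.compl
  have hopen : IsOpen ({y1, y2}ᶜ : Set E3) := (Set.toFinite _).isClosed.isOpen_compl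
  set J : E3 → ℝ := X.indicator H' with hJ
  have hJi : Integrable J := hIntg.integrable_indicator hXm
  set η : ℝ → E3 → ℝ := fun ε x => eta y1 s ε x + eta y2 t ε x - 1 with hη
  have hηc : ∀ ε, ContDiff ℝ (⊤ : ℕ∞) (η ε) := fun ε =>
    ((eta_contDiff y1 s ε).add (eta_contDiff y2 t ε)).sub contDiff_const
  have hη1 : ∀ ε x, |η ε x| ≤ 1 := by
    intro ε x
    have := eta_nonneg y1 s ε x
    have := eta_nonneg y2 t ε x
    have := eta_le_one y1 s ε x
    have := eta_le_one y2 t ε x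
    simp only [hη]
    rw [abs_le]; constructor <;> linarith
  have hc1 : ContinuousOn H {x | dist x y1 ∈ Set.Icc s (d - t)} := by
    refine hH.continuousOn.mono ?_
    rintro x ⟨h1, h2⟩ (rfl | h)
    · rw [dist_self] at h1; linarith
    · rw [Set.mem_singleton_iff] at h
      subst h
      rw [dist_comm, ← hd] at h2; linarith
  have hc2 : ContinuousOn H {x | dist x y2 ∈ Set.Icc t (d - s)} := by
    refine hH.continuousOn.mono ?_
    rintro x ⟨h1, h2⟩ (rfl | h)
    · rw [← hd] at h2; linarith
    · rw [Set.mem_singleton_iff] at h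
      subst h
      rw [dist_self] at h1; linarith
  have hsmall : ∀ᶠ ε in 𝓝[>] (0:ℝ), s ^ 2 + ε ≤ (d - t) ^ 2 ∧ t ^ 2 + ε ≤ (d - s) ^ 2 := by
    refine nhdsWithin_le_nhds ?_
    have a1 : ∀ᶠ ε in 𝓝 (0:ℝ), ε < (d - t) ^ 2 - s ^ 2 := eventually_lt_nhds (by nlinarith)
    have a2 : ∀ᶠ ε in 𝓝 (0:ℝ), ε < (d - s) ^ 2 - t ^ 2 := eventually_lt_nhds (by nlinarith)
    filter_upwards [a1, a2] with ε h1 h2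
    constructor <;> linarith
  have key : ∀ᶠ ε in 𝓝[>] (0:ℝ), ∫ x, η ε x * J x
      = - (∫ x, pder i (eta y1 s ε) x * H x) - ∫ x, pder i (eta y2 t ε) x * H x := by
    filter_upwards [hsmall, self_mem_nhdsWithin] with ε ⟨h1, h2⟩ hε
    have hε : 0 < ε := hε
    have far1 : ∀ x, dist x y1 ≤ s → t ^ 2 + ε ≤ dist x y2 ^ 2 := by
      intro x hx
      have : d ≤ dist x y1 + dist x y2 := by
        rw [hd, dist_comm x y1]; exact dist_triangle _ _ _
      nlinarith
    have far2 : ∀ x, dist x y2 ≤ t → s ^ 2 + ε ≤ dist x y1 ^ 2 := by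
      intro x hx
      have : d ≤ dist x y1 + dist x y2 := by
        rw [hd, dist_comm x y1]; exact dist_triangle _ _ _
      nlinarith
    have z1 : ∀ x, dist x y1 ≤ s → η ε x = 0 := by
      intro x hx
      simp only [hη]
      rw [eta_zero y1 s ε hε x hx, eta_one y2 t ε hε x (far1 x hx)]; simp
    have z2 : ∀ x, dist x y2 ≤ t → η ε x = 0 := by
      intro x hx
      simp only [hη]
      rw [eta_zero y2 t ε hε x hx, eta_one y1 s ε hε x (far2 x hx)]; simp
    have hηJ : ∀ x, η ε x * J x = η ε x * H' x := by
      intro x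
      by_cases hx : x ∈ X
      · simp [hJ, hx]
      · have : η ε x = 0 := by
          simp only [hX, Set.mem_compl_iff, not_not] at hx
          rcases hx with hx | hx
          · exact z1 x hx
          · exact z2 x hx
        simp [this]
    set K : E3 → ℝ := fun x => η ε x * H x with hK
    have hK1 : ∀ x, dist x y1 < s → K =ᶠ[𝓝 x] fun _ => 0 := by
      intro x hx
      filter_upwards [Metric.isOpen_ball.mem_nhds (Metric.mem_ball.2 hx)] with z hz
      simp [hK, z1 z (le_of_lt hz)]
    have hK2 : ∀ x, dist x y2 < t → K =ᶠ[𝓝 x] fun _ => 0 := by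
      intro x hx
      filter_upwards [Metric.isOpen_ball.mem_nhds (Metric.mem_ball.2 hx)] with z hz
      simp [hK, z2 z (le_of_lt hz)]
    have hoff : ∀ x, ¬ dist x y1 < s → ¬ dist x y2 < t → x ∈ ({y1, y2}ᶜ : Set E3) := by
      rintro x hx1 hx2 (rfl | h)
      · simp [hs] at hx1
      · rw [Set.mem_singleton_iff] at h; subst h; simp [ht] at hx2
    have hKs : ContDiff ℝ (⊤ : ℕ∞) K := by
      rw [contDiff_iff_contDiffAt]
      intro x
      by_cases hx1 : dist x y1 < s
      · exact contDiffAt_const.congr_of_eventuallyEq (hK1 x hx1)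
      by_cases hx2 : dist x y2 < t
      · exact contDiffAt_const.congr_of_eventuallyEq (hK2 x hx2)
      exact (hηc ε).contDiffAt.mul (hH.contDiffAt (hopen.mem_nhds (hoff x hx1 hx2)))
    have hpK : ∀ x, pder i K x = η ε x * J x + pder i (eta y1 s ε) x * H x
        + pder i (eta y2 t ε) x * H x := by
      intro x
      rw [hηJ]
      by_cases hx1 : dist x y1 < s
      · rw [z1 x hx1.le, pder_eta_zero i y1 s ε hε x (Or.inl hx1.le),
          pder_eta_zero i y2 t ε hε x (Or.inr (far1 x hx1.le))]
        unfold pder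
        rw [(hK1 x hx1).fderiv_eq]; simp
      by_cases hx2 : dist x y2 < t
      · rw [z2 x hx2.le, pder_eta_zero i y2 t ε hε x (Or.inl hx2.le),
          pder_eta_zero i y1 s ε hε x (Or.inr (far2 x hx2.le))]
        unfold pder
        rw [(hK2 x hx2).fderiv_eq]; simp
      have hxo := hoff x hx1 hx2
      have hHd : DifferentiableAt ℝ H x :=
        (hH.contDiffAt (hopen.mem_nhds hxo)).differentiableAt (by simp)
      have he1 : DifferentiableAt ℝ (eta y1 s ε) x :=
        (eta_contDiff y1 s ε).differentiable (by simp) x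
      have he2 : DifferentiableAt ℝ (eta y2 t ε) x :=
        (eta_contDiff y2 t ε).differentiable (by simp) x
      rw [← hH' x hxo]
      have hf := ((he1.hasFDerivAt.add he2.hasFDerivAt).sub_const 1).mul hHd.hasFDerivAt
      have hf : HasFDerivAt K _ x := hf
      unfold pder
      rw [hf.fderiv]
      simp [hη]
      ring
    have i1 := layer_integrable i y1 H s (d - t) ε (by linarith) hε h1 hc1
    have i2 := layer_integrable i y2 H t (d - s) ε (by linarith) hε h2 hc2
    have i0 : Integrable (fun x => η ε x * J x) :=
      hJi.bdd_mul (c := 1) (hηc ε).continuous.aestronglyMeasurable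
        (Eventually.of_forall fun x => hη1 ε x)
    have hz := int_pder_zero i K (hKs.of_le (by simp)) ?_ ?_
    · have : ∫ x, pder i K x = (∫ x, η ε x * J x) + (∫ x, pder i (eta y1 s ε) x * H x)
          + ∫ x, pder i (eta y2 t ε) x * H x := by
        simp_rw [hpK]
        have i01 : Integrable (fun x => η ε x * J x + pder i (eta y1 s ε) x * H x) := i0.add i1
        rw [integral_add i01 i2, integral_add i0 i1]
      linarith
    · exact ((i0.add i1).add i2).congr (Eventually.of_forall fun x => (hpK x).symm)
    · refine squeeze_zero_norm (fun x => ?_) (tendsto_norm_zero.comp hdec)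
      simp only [Function.comp, hK, norm_mul]
      have := hη1 ε x
      rw [← Real.norm_eq_abs] at this
      gcongr
      exact mul_le_of_le_one_left (norm_nonneg _) this
  have lim1 : Tendsto (fun ε => ∫ x, η ε x * J x) (𝓝[>] 0) (𝓝 (∫ x, J x)) := by
    refine tendsto_integral_filter_of_dominated_convergence (fun x => ‖J x‖) ?_ ?_ hJi.norm ?_
    · exact Eventually.of_forall fun ε =>
        (hηc ε).continuous.aestronglyMeasurable.mul hJi.aestronglyMeasurable
    · refine Eventually.of_forall fun ε => Eventually.of_forall fun x => ?_
      rw [norm_mul]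
      exact mul_le_of_le_one_left (norm_nonneg _) (hη1 ε x)
    · refine Eventually.of_forall fun x => ?_
      by_cases hx : x ∈ X
      · have hx' : s < dist x y1 ∧ t < dist x y2 := by
          simpa [hX, not_or] using hx
        refine tendsto_const_nhds.congr' ?_
        have a1 : ∀ᶠ ε in 𝓝 (0:ℝ), ε < dist x y1 ^ 2 - s ^ 2 :=
          eventually_lt_nhds (by nlinarith [hx'.1])
        have a2 : ∀ᶠ ε in 𝓝 (0:ℝ), ε < dist x y2 ^ 2 - t ^ 2 :=
          eventually_lt_nhds (by nlinarith [hx'.2])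
        filter_upwards [nhdsWithin_le_nhds a1, nhdsWithin_le_nhds a2, self_mem_nhdsWithin]
          with ε h1 h2 hε
        simp only [hη]
        rw [eta_one y1 s ε hε x (by linarith), eta_one y2 t ε hε x (by linarith)]
        ring
      · simp [hJ, hx]
  have lim2 := ((layer i y1 H s (d - t) hs (by linarith) hc1).neg).sub
    (layer i y2 H t (d - s) ht (by linarith) hc2)
  have := tendsto_nhds_unique (lim1.congr' key) lim2
  rw [← this, hJ, integral_indicator hXm]

def sphInt (y : E3) (H : E3 → ℝ) (r : ℝ) : ℝ := ∫ n : S2, H (y + r • (n : E3)) ∂dOmega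

lemma sphInt_cont (y : E3) (H : E3 → ℝ) (s ρ : ℝ) (hs : 0 < s)
    (hH : ContinuousOn H {x | dist x y ∈ Set.Icc s ρ}) :
    ContinuousOn (sphInt y H) (Set.Icc s ρ) := by
  unfold sphInt
  rw [continuousOn_iff_continuous_domRestrict]
  have : Continuous (fun r : Set.Icc s ρ =>
      ∫ n in (Set.univ : Set S2), H (y + (r:ℝ) • (n : E3)) ∂dOmega) := by
    refine continuous_parametric_integral_of_continuous (X := Set.Icc s ρ) ?_ isCompact_univ
    refine hH.comp_continuous (by fun_prop) fun p => ?_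
    simp only [Set.mem_ofPred_eq]
    rw [dist_polar y _ (hs.trans_le p.1.2.1)]
    exact p.1.2
  simp only [Measure.restrict_univ] at this
  exact this

lemma flux_diff (i : Fin 3) (y1 y2 : E3) (s ρ t : ℝ) (hs : 0 < s) (hsρ : s < ρ) (ht : 0 < t)
    (hst : ρ + t < dist y1 y2) (H H' : E3 → ℝ)
    (hH : ContDiffOn ℝ (⊤ : ℕ∞) H ({y1, y2}ᶜ : Set E3))
    (hH' : ∀ x ∈ ({y1, y2}ᶜ : Set E3), pder i H x = H' x)
    (hIntg : IntegrableOn H' (Metric.closedBall y1 s ∪ Metric.closedBall y2 t)ᶜ)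
    (hdec : Tendsto (fun x : E3 => ‖x‖ ^ 2 * H x) (cocompact E3) (𝓝 0)) :
    ∫ r in s..ρ, r ^ 2 * sphInt y1 H' r = flux i y1 H ρ - flux i y1 H s := by
  have hsub : (Metric.closedBall y1 ρ ∪ Metric.closedBall y2 t)ᶜ
      ⊆ (Metric.closedBall y1 s ∪ Metric.closedBall y2 t)ᶜ :=
    Set.compl_subset_compl.2 (Set.union_subset_union_left _ (Metric.closedBall_subset_closedBall hsρ.le))
  have e1 := div_ext i y1 y2 s t hs ht (by linarith) H H' hH hH' hIntg hdec
  have e2 := div_ext i y1 y2 ρ t (hs.trans hsρ) ht hst H H' hH hH' (hIntg.mono_set hsub) hdec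
  have hu : (Metric.closedBall y1 s ∪ Metric.closedBall y2 t)ᶜ
      = (Metric.closedBall y1 ρ ∪ Metric.closedBall y2 t)ᶜ ∪ {x | dist x y1 ∈ Set.Ioc s ρ} := by
    ext x
    have tri : dist y1 y2 ≤ dist x y1 + dist x y2 := by
      rw [dist_comm x y1]; exact dist_triangle _ _ _
    simp only [Set.mem_compl_iff, Set.mem_union, Metric.mem_closedBall, not_or, not_le,
      Set.mem_ofPred_eq, Set.mem_Ioc]
    constructor
    · rintro ⟨h1, h2⟩
      rcases le_or_gt (dist x y1) ρ with h | h
      · exact Or.inr ⟨h1, h⟩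
      · exact Or.inl ⟨h, h2⟩
    · rintro (⟨h1, h2⟩ | ⟨h1, h2⟩)
      · exact ⟨hsρ.trans h1, h2⟩
      · exact ⟨h1, by linarith⟩
  have hdis : Disjoint (Metric.closedBall y1 ρ ∪ Metric.closedBall y2 t)ᶜ
      {x : E3 | dist x y1 ∈ Set.Ioc s ρ} := by
    rw [Set.disjoint_left]
    rintro x hx ⟨_, h2⟩
    exact hx (Or.inl h2)
  have hm : MeasurableSet {x : E3 | dist x y1 ∈ Set.Ioc s ρ} :=
    (measurable_id.dist measurable_const) measurableSet_Ioc
  have hsh : IntegrableOn H' {x : E3 | dist x y1 ∈ Set.Ioc s ρ} :=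
    hIntg.mono_set (by rw [hu]; exact Set.subset_union_right)
  rw [hu, setIntegral_union hdis hm (hIntg.mono_set hsub) hsh, e2,
    polar_set H' y1 _ measurableSet_Ioc (fun r hr => hs.trans hr.1) hsh] at e1
  rw [intervalIntegral.integral_of_le hsρ.le]
  simp only [sphInt]
  linarith

lemma radial (T T' : Finset ℝ) (C E : ℝ → ℝ) (M : ℝ) (φ ψ : ℝ → ℝ) (ρ0 : ℝ) (hρ0 : 0 < ρ0)
    (hφ : ∀ᶠ r in 𝓝[>] (0:ℝ), |φ r - r ^ 2 * ∑ a ∈ T, r ^ a * C a| ≤ M * r ^ 2)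
    (hψ : ∀ᶠ r in 𝓝[>] (0:ℝ), |ψ r - ∑ a ∈ T', r ^ a * E a| ≤ M)
    (hψc : ∀ s ρ, 0 < s → s < ρ → ρ < ρ0 → ContinuousOn ψ (Set.Icc s ρ))
    (hd : ∀ s ρ, 0 < s → s < ρ → ρ < ρ0 → ∫ r in s..ρ, r ^ 2 * ψ r = φ ρ - φ s)
    (hT : -2 ∉ T → C (-2) = 0) (hT' : -3 ∉ T' → E (-3) = 0) :
    E (-3) = 0 ∧ Tendsto (fun s => φ s - ∑ a ∈ T' with a < -3, s ^ (a + 3) / (a + 3) * E a)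
      (𝓝[>] 0) (𝓝 (C (-2))) := by
  classical
  have hpow : ∀ r : ℝ, 0 < r → r ^ 2 * ∑ a ∈ T, r ^ a * C a = ∑ a ∈ T, r ^ (a + 2) * C a := by
    intro r hr
    rw [Finset.mul_sum]
    refine Finset.sum_congr rfl fun a _ => ?_
    rw [Real.rpow_add hr]
    norm_num
    ring
  set P : ℝ → ℝ := fun r => ∑ a ∈ T', r ^ (a + 3) * (E a / (a + 3)) + E (-3) * Real.log r with hP
  have hPd : ∀ r : ℝ, 0 < r → HasDerivAt P (r ^ 2 * ∑ a ∈ T', r ^ a * E a) r := by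
    intro r hr
    have h1 : HasDerivAt P (∑ a ∈ T', ((a + 3) * r ^ (a + 3 - 1)) * (E a / (a + 3))
        + E (-3) * r⁻¹) r := by
      refine HasDerivAt.add (HasDerivAt.fun_sum fun a _ => ?_) ?_
      · exact (Real.hasDerivAt_rpow_const (Or.inl hr.ne')).mul_const _
      · exact (Real.hasDerivAt_log hr.ne').const_mul _
    convert h1 using 1
    have h2 : E (-3) * r⁻¹ = ∑ a ∈ T', if a = -3 then E (-3) * r⁻¹ else 0 := by
      rw [Finset.sum_ite_eq' ]
      split_ifs with h
      · rfl
      · rw [hT' h]; simp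
    rw [h2, ← Finset.sum_add_distrib, Finset.mul_sum]
    refine Finset.sum_congr rfl fun a _ => ?_
    have h3 : r ^ (a + 3 - 1) = r ^ 2 * r ^ a := by
      rw [show a + 3 - 1 = 2 + a by ring, Real.rpow_add hr]; norm_num
    split_ifs with h
    · subst h
      have : r ^ (2:ℕ) * r ^ (-3:ℝ) = r⁻¹ := by
        rw [← Real.rpow_natCast, ← Real.rpow_add hr, ← Real.rpow_neg_one]; norm_num
      simp only [← mul_assoc]
      rw [this]; norm_num; ring
    · have h4 : a + 3 ≠ 0 := fun hh => h (by linarith)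
      rw [h3]; field_simp; simp
  -- a good radius
  obtain ⟨u, hu0, hu⟩ : ∃ u > 0, ∀ r, 0 < r → r < u →
      |φ r - r ^ 2 * ∑ a ∈ T, r ^ a * C a| ≤ M * r ^ 2 ∧ |ψ r - ∑ a ∈ T', r ^ a * E a| ≤ M := by
    have := hφ.and hψ
    rw [eventually_nhdsWithin_iff, Metric.eventually_nhds_iff] at this
    obtain ⟨u, hu, h⟩ := this
    refine ⟨u, hu, fun r hr hru => h ?_ hr⟩
    rw [Real.dist_eq, sub_zero, abs_of_pos hr]; exact hru
  have hM : 0 ≤ M := by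
    have := (hu (u / 2) (by positivity) (by linarith)).2
    exact (abs_nonneg _).trans this
  set ρ := min (min u ρ0) 1 / 2 with hρ
  have hρp : 0 < ρ := by positivity
  have hρu : ρ < u := by
    have := min_le_left (min u ρ0) 1
    have := min_le_left u ρ0
    have : 0 < min (min u ρ0) 1 := by positivity
    linarith
  have hρρ : ρ < ρ0 := by
    have := min_le_left (min u ρ0) 1
    have := min_le_right u ρ0
    have : 0 < min (min u ρ0) 1 := by positivity
    linarith
  have hρ1 : ρ ≤ 1 := by
    have := min_le_right (min u ρ0) 1
    linarith
  have hb : ∀ s, 0 < s → s < ρ →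
      |(φ ρ - φ s) - (P ρ - P s)| ≤ M := by
    intro s hs hsρ
    have ic1 : IntervalIntegrable (fun r => r ^ 2 * ψ r) volume s ρ := by
      apply ContinuousOn.intervalIntegrable
      rw [Set.uIcc_of_le hsρ.le]
      exact (continuous_pow 2).continuousOn.mul (hψc s ρ hs hsρ hρρ)
    have ic2 : IntervalIntegrable (fun r => r ^ 2 * ∑ a ∈ T', r ^ a * E a) volume s ρ := by
      apply ContinuousOn.intervalIntegrable
      rw [Set.uIcc_of_le hsρ.le]
      refine (continuous_pow 2).continuousOn.mul (continuousOn_finsetSum _ fun a _ => ?_)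
      refine ContinuousOn.mul (fun r hr => ?_) continuousOn_const
      exact (Real.continuousAt_rpow_const r a (Or.inl (hs.trans_le hr.1).ne')).continuousWithinAt
    have e2 : ∫ r in s..ρ, r ^ 2 * ∑ a ∈ T', r ^ a * E a = P ρ - P s := by
      refine intervalIntegral.integral_eq_sub_of_hasDerivAt (fun r hr => ?_) ic2
      rw [Set.uIcc_of_le hsρ.le] at hr
      exact hPd r (hs.trans_le hr.1)
    rw [← e2, ← hd s ρ hs hsρ hρρ, ← intervalIntegral.integral_sub ic1 ic2, ← Real.norm_eq_abs]
    refine (intervalIntegral.norm_integral_le_of_norm_le_const (C := M) fun r hr => ?_).trans ?_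
    · rw [Set.uIoc_of_le hsρ.le] at hr
      have hr0 : 0 < r := hs.trans hr.1
      rw [← mul_sub, norm_mul, Real.norm_eq_abs, Real.norm_eq_abs]
      have h1 := (hu r hr0 (hr.2.trans_lt hρu)).2
      have h2 : |r ^ 2| ≤ 1 := by
        rw [abs_of_nonneg (by positivity)]
        have := hr.2
        nlinarith
      calc _ ≤ 1 * M := by gcongr
        _ = M := one_mul M
    · rw [abs_of_pos (by linarith)]
      nlinarith
  have hmain := asym_indexed (T.disjSum T') (Sum.elim (fun a => a + 2) (fun a => a + 3))
    (Sum.elim C (fun a => -(E a / (a + 3)))) (-E (-3)) (M + M + |φ ρ - P ρ|) ?_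
  · obtain ⟨h1, -, h3⟩ := hmain
    have hE : E (-3) = 0 := by linarith
    refine ⟨hE, ?_⟩
    have h4 : ∑ j ∈ T.disjSum T' with Sum.elim (fun a => a + 2) (fun a => a + 3) j = (0:ℝ),
        Sum.elim C (fun a => -(E a / (a + 3))) j = C (-2) := by
      rw [Finset.sum_filter, Finset.sum_disjSum]
      simp only [Sum.elim_inl, Sum.elim_inr]
      have k1 : (∑ a ∈ T, if a + 2 = 0 then C a else 0) = C (-2) := by
        rw [Finset.sum_congr rfl (g := fun a => if a = -2 then C (-2) else 0)]
        · rw [Finset.sum_ite_eq']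
          split_ifs with h
          · rfl
          · exact (hT h).symm
        · intro a _
          by_cases h : a = -2
          · subst h; norm_num
          · rw [if_neg h, if_neg fun hh => h (by linarith)]
      have k2 : (∑ a ∈ T', if a + 3 = 0 then -(E a / (a + 3)) else 0) = 0 := by
        refine Finset.sum_eq_zero fun a _ => ?_
        split_ifs with h
        · simp [h]
        · rfl
      have k3 : (∑ a ∈ T, if a + 2 = 0 then C a else 0)
          + (∑ a ∈ T', if a + 3 = 0 then -(E a / (a + 3)) else 0) = C (-2) := by
        rw [k1, k2, add_zero]
      exact k3
    rw [h4] at h3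
    simp only [Finset.sum_disjSum, Sum.elim_inl, Sum.elim_inr] at h3
    have l1 : Tendsto (fun s => φ s - s ^ 2 * ∑ a ∈ T, s ^ a * C a) (𝓝[>] 0) (𝓝 0) := by
      refine squeeze_zero_norm' (a := fun s => M * s ^ 2) ?_ ?_
      · exact hφ
      · have : Continuous fun s : ℝ => M * s ^ 2 := by fun_prop
        have := this.tendsto 0
        simp only [ne_eq, OfNat.ofNat_ne_zero, not_false_eq_true, zero_pow, mul_zero] at this
        exact this.mono_left nhdsWithin_le_nhds
    have l2 : Tendsto (fun s : ℝ => ∑ a ∈ T' with ¬ a < -3, s ^ (a + 3) / (a + 3) * E a)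
        (𝓝[>] 0) (𝓝 0) := by
      rw [← Finset.sum_const_zero (s := T'.filter fun a => ¬ a < -3)]
      refine tendsto_finsetSum _ fun a ha => ?_
      rw [Finset.mem_filter, not_lt] at ha
      by_cases h : a = -3
      · subst h; simp [hE]
      · have hp : 0 < a + 3 := by
          have := lt_of_le_of_ne ha.2 (Ne.symm h)
          linarith
        have := ((Real.continuousAt_rpow_const 0 (a + 3) (Or.inr hp.le)).tendsto.mono_left
          (nhdsWithin_le_nhds (s := Set.Ioi 0))).div_const (a + 3) |>.mul_const (E a)
        simpa [Real.zero_rpow hp.ne'] using this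
    have := (l1.add h3).add l2
    simp only [zero_add, add_zero] at this
    refine this.congr' ?_
    filter_upwards [self_mem_nhdsWithin] with s hs
    rw [hpow s hs]
    have hsp := Finset.sum_filter_add_sum_filter_not T' (fun a => a < -3)
      (fun a => s ^ (a + 3) / (a + 3) * E a)
    have hq : ∑ a ∈ T', s ^ (a + 3) * -(E a / (a + 3))
        = - ∑ a ∈ T', s ^ (a + 3) / (a + 3) * E a := by
      rw [← Finset.sum_neg_distrib]
      refine Finset.sum_congr rfl fun a _ => ?_
      ring
    rw [hq]
    linarith
  · have hlt : ∀ᶠ s in 𝓝[>] (0:ℝ), s < ρ := nhdsWithin_le_nhds (eventually_lt_nhds hρp)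
    filter_upwards [hlt, self_mem_nhdsWithin] with s hs hs0
    have hs0 : 0 < s := hs0
    have b1 := hb s hs0 hs
    have b2 := (hu s hs0 (hs.trans hρu)).1
    rw [hpow s hs0] at b2
    have b3 : M * s ^ 2 ≤ M := by
      have : s ^ 2 ≤ 1 := by nlinarith
      nlinarith
    simp only [Finset.sum_disjSum, Sum.elim_inl, Sum.elim_inr, mul_neg, Finset.sum_neg_distrib]
    have b4 : ∑ a ∈ T', s ^ (a + 3) * (E a / (a + 3)) = P s - E (-3) * Real.log s := by
      simp [hP]
    rw [b4]
    rw [abs_le] at b1 b2 ⊢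
    have := neg_abs_le (φ ρ - P ρ)
    have := le_abs_self (φ ρ - P ρ)
    constructor <;> linarith [b1.1, b1.2, b2.1, b2.2]

lemma coord_le (i : Fin 3) (n : S2) : |(n : E3) i| ≤ 1 := by
  have := PiLp.norm_apply_le (n : E3) i
  rwa [norm_S2, Real.norm_eq_abs] at this

lemma sphere_cont (y1 y2 : E3) (hy : y1 ≠ y2) (F : E3 → ℝ)
    (hF : ContinuousOn F ({y1, y2}ᶜ : Set E3)) :
    ∀ᶠ r in 𝓝[>] (0:ℝ), Continuous fun n : S2 => F (y1 + r • (n : E3)) := by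
  have h1 : ∀ᶠ r in 𝓝[>] (0:ℝ), r < dist y1 y2 :=
    nhdsWithin_le_nhds (eventually_lt_nhds (dist_pos.2 hy))
  filter_upwards [h1, self_mem_nhdsWithin] with r hr hr0
  have hr0 : 0 < r := hr0
  refine hF.comp_continuous (by fun_prop) fun n => ?_
  have hd := dist_polar y1 r hr0 n
  rintro (h | h)
  · rw [h, dist_self] at hd; linarith
  · rw [Set.mem_singleton_iff] at h
    rw [h, dist_comm] at hd; linarith

lemma point_limit (i : Fin 3) (y1 y2 : E3) (hy : y1 ≠ y2) (H H' : E3 → ℝ) (h c : ℝ → S2 → ℝ)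
    (hH : ContDiffOn ℝ (⊤ : ℕ∞) H ({y1, y2}ᶜ : Set E3))
    (hHc : ContinuousOn H' ({y1, y2}ᶜ : Set E3))
    (hH' : ∀ x ∈ ({y1, y2}ᶜ : Set E3), pder i H x = H' x)
    (hIntg : ∀ s t, 0 < s → 0 < t →
      IntegrableOn H' (Metric.closedBall y1 s ∪ Metric.closedBall y2 t)ᶜ)
    (hdec : Tendsto (fun x : E3 => ‖x‖ ^ 2 * H x) (cocompact E3) (𝓝 0))
    (eH : HasSingExpansion y1 H h) (eH' : HasSingExpansion y1 H' c) :
    (∫ n : S2, c (-3) n ∂dOmega) = 0 ∧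
    Tendsto (fun s => flux i y1 H s
        - ∑ᶠ (a : ℝ) (_ : a < -3), s ^ (a + 3) / (a + 3) * ∫ n : S2, c a n ∂dOmega)
      (𝓝[>] 0) (𝓝 (∫ n : S2, (n : E3) i * h (-2) n ∂dOmega)) := by
  obtain ⟨T, hT, -⟩ := exp_finset eH 0
  obtain ⟨T', hT', -⟩ := exp_finset eH' 0
  have x1 := exp_int eH (fun n => (n : E3) i) (coord_cont i) (coord_le i)
    (sphere_cont y1 y2 hy H hH.continuousOn) T hT
  have x2 := exp_int eH' (fun _ => 1) continuous_const (by simp)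
    (sphere_cont y1 y2 hy H' hHc) T' hT'
  simp only [one_mul] at x2
  have hd0 : 0 < dist y1 y2 := dist_pos.2 hy
  simp_rw [fun s => finsum_lt_eq T' hT' s]
  refine radial T T' (fun a => ∫ n : S2, (n : E3) i * h a n ∂dOmega)
    (fun a => ∫ n : S2, c a n ∂dOmega) (dOmega.real Set.univ) (flux i y1 H) (sphInt y1 H')
    (dist y1 y2 / 2) (by positivity) ?_ x2 ?_ ?_ ?_ ?_
  · filter_upwards [x1] with r hr
    unfold flux
    rw [← mul_sub, abs_mul, abs_of_nonneg (sq_nonneg r), mul_comm]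
    exact mul_le_mul_of_nonneg_right hr (sq_nonneg r)
  · intro s ρ hs hsρ hρ
    refine sphInt_cont y1 H' s ρ hs (hHc.mono ?_)
    rintro x ⟨h1, h2⟩ (rfl | h)
    · rw [dist_self] at h1; linarith
    · rw [Set.mem_singleton_iff] at h
      subst h
      rw [dist_comm] at h2; linarith
  · intro s ρ hs hsρ hρ
    exact flux_diff i y1 y2 s ρ (dist y1 y2 / 2) hs hsρ (by positivity) (by linarith) H H' hH hH'
      (hIntg _ _ hs (by positivity)) hdec
  · intro hn
    have : h (-2) = 0 := by
      by_contra hc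
      exact hn ((hT _).2 ⟨by norm_num, hc⟩)
    simp [this]
  · intro hn
    have : c (-3) = 0 := by
      by_contra hc
      exact hn ((hT' _).2 ⟨by norm_num, hc⟩)
    simp [this]

lemma int_ext (y1 y2 : E3) (A : E3 → ℝ) (hc : ContinuousOn A ({y1, y2}ᶜ : Set E3))
    (hR : ∃ R : ℝ, IntegrableOn A (Metric.closedBall 0 R)ᶜ volume) (s t : ℝ) (hs : 0 < s)
    (ht : 0 < t) : IntegrableOn A (Metric.closedBall y1 s ∪ Metric.closedBall y2 t)ᶜ := by
  obtain ⟨R, hR⟩ := hR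
  have hk : IsCompact (Metric.closedBall (0:E3) R \ (Metric.ball y1 s ∪ Metric.ball y2 t)) :=
    (isCompact_closedBall 0 R).diff (Metric.isOpen_ball.union Metric.isOpen_ball)
  have h2 : IntegrableOn A (Metric.closedBall (0:E3) R \ (Metric.ball y1 s ∪ Metric.ball y2 t)) := by
    refine (hc.mono ?_).integrableOn_compact hk
    rintro x ⟨_, hx⟩ (rfl | h)
    · exact hx (Or.inl (Metric.mem_ball_self hs))
    · rw [Set.mem_singleton_iff] at h
      subst h
      exact hx (Or.inr (Metric.mem_ball_self ht))
  refine (hR.union h2).mono_set fun x hx => ?_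
  by_cases hxR : x ∈ Metric.closedBall (0:E3) R
  · refine Or.inr ⟨hxR, fun hxx => hx ?_⟩
    exact Set.union_subset_union Metric.ball_subset_closedBall Metric.ball_subset_closedBall hxx
  · exact Or.inl hxR

lemma coeff_int_add {y : E3} {A B : E3 → ℝ} {c d : ℝ → S2 → ℝ} (hA : HasSingExpansion y A c)
    (hB : HasSingExpansion y B d) (a : ℝ) :
    ∫ n : S2, (c + d) a n ∂dOmega = (∫ n : S2, c a n ∂dOmega) + ∫ n : S2, d a n ∂dOmega :=
  integral_add (cont_int (smooth_cont (hA.smooth_coeffs a)))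
    (cont_int (smooth_cont (hB.smooth_coeffs a)))

lemma sub_support {y : E3} {A : E3 → ℝ} {c : ℝ → S2 → ℝ} (hA : HasSingExpansion y A c) (s : ℝ) :
    ({a : ℝ | a < -3} ∩ Function.support fun a : ℝ =>
      s ^ (a + 3) / (a + 3) * ∫ n : S2, c a n ∂dOmega).Finite := by
  refine (hA.finite_exponents (-3)).subset ?_
  rintro a ⟨h1, h2⟩
  refine ⟨le_of_lt h1, fun h => h2 ?_⟩
  simp [h]

lemma finsum_coeff_add {y : E3} {A B : E3 → ℝ} {c d : ℝ → S2 → ℝ} (hA : HasSingExpansion y A c)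
    (hB : HasSingExpansion y B d) (s : ℝ) :
    (∑ᶠ (a : ℝ) (_ : a < -3), s ^ (a + 3) / (a + 3) * ∫ n : S2, (c + d) a n ∂dOmega)
    = (∑ᶠ (a : ℝ) (_ : a < -3), s ^ (a + 3) / (a + 3) * ∫ n : S2, c a n ∂dOmega)
      + ∑ᶠ (a : ℝ) (_ : a < -3), s ^ (a + 3) / (a + 3) * ∫ n : S2, d a n ∂dOmega := by
  have := finsum_mem_add_distrib' (s := {a : ℝ | a < -3}) (sub_support hA s) (sub_support hB s)
  simp_rw [coeff_int_add hA hB, mul_add]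
  exact this

lemma key_identity (y₁ y₂ : E3) (hy : y₁ ≠ y₂) (s₁ s₂ : ℝ) (i : Fin 3)
    (F G A B : E3 → ℝ) (h₁ h₂ a₁ a₂ b₁ b₂ : ℝ → S2 → ℝ)
    (mF : ContDiffOn ℝ (⊤ : ℕ∞) F ({y₁, y₂}ᶜ : Set E3))
    (mG : ContDiffOn ℝ (⊤ : ℕ∞) G ({y₁, y₂}ᶜ : Set E3))
    (hA : A = fun x => pder i F x * G x) (hB : B = fun x => pder i G x * F x)
    (mH : MemF y₁ y₂ (fun x => F x * G x) h₁ h₂)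
    (mA : MemF y₁ y₂ A a₁ a₂) (mB : MemF y₁ y₂ B b₁ b₂)
    (hdec : Tendsto (fun x : E3 => ‖x‖ ^ 2 * (F x * G x)) (cocompact E3) (𝓝 0))
    (iA : ∃ R : ℝ, IntegrableOn A (Metric.closedBall 0 R)ᶜ volume)
    (iB : ∃ R : ℝ, IntegrableOn B (Metric.closedBall 0 R)ᶜ volume)
    (LA LB : ℝ) (pA : HasPfIntegral y₁ y₂ s₁ s₂ A a₁ a₂ LA)
    (pB : HasPfIntegral y₁ y₂ s₁ s₂ B b₁ b₂ LB) :
    LA + LB = - ((∫ n : S2, (n : E3) i * h₁ (-2) n ∂dOmega)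
      + ∫ n : S2, (n : E3) i * h₂ (-2) n ∂dOmega) := by
  have hopen : IsOpen ({y₁, y₂}ᶜ : Set E3) := (Set.toFinite _).isClosed.isOpen_compl
  set H : E3 → ℝ := fun x => F x * G x with hH
  set H' : E3 → ℝ := fun x => A x + B x with hH'
  have hp : ∀ x ∈ ({y₁, y₂}ᶜ : Set E3), pder i H x = H' x := by
    intro x hx
    have dF : DifferentiableAt ℝ F x :=
      (mF.contDiffAt (hopen.mem_nhds hx)).differentiableAt (by simp)
    have dG : DifferentiableAt ℝ G x :=
      (mG.contDiffAt (hopen.mem_nhds hx)).differentiableAt (by simp)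
    have hf : HasFDerivAt H _ x := dF.hasFDerivAt.mul dG.hasFDerivAt
    simp only [hH', hA, hB]
    unfold pder
    rw [hf.fderiv]
    simp
    ring
  have hcH' : ContinuousOn H' ({y₁, y₂}ᶜ : Set E3) :=
    mA.smooth.continuousOn.add mB.smooth.continuousOn
  have IA := int_ext y₁ y₂ A mA.smooth.continuousOn iA
  have IB := int_ext y₁ y₂ B mB.smooth.continuousOn iB
  have IH : ∀ s t, 0 < s → 0 < t →
      IntegrableOn H' (Metric.closedBall y₁ s ∪ Metric.closedBall y₂ t)ᶜ :=
    fun s t hs ht => (IA s t hs ht).add (IB s t hs ht)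
  have P1 := point_limit i y₁ y₂ hy H H' h₁ (a₁ + b₁) mH.smooth hcH' hp IH hdec mH.exp₁
    (exp_add mA.exp₁ mB.exp₁)
  have P2 := point_limit i y₂ y₁ hy.symm H H' h₂ (a₂ + b₂)
    (by rw [Set.pair_comm]; exact mH.smooth) (by rw [Set.pair_comm]; exact hcH')
    (by rw [Set.pair_comm]; exact hp)
    (fun s t hs ht => by rw [Set.union_comm]; exact IH t s ht hs) hdec mH.exp₂
    (exp_add mA.exp₂ mB.exp₂)
  obtain ⟨z1, l1⟩ := P1
  obtain ⟨z2, l2⟩ := P2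
  rw [coeff_int_add mA.exp₁ mB.exp₁] at z1
  rw [coeff_int_add mA.exp₂ mB.exp₂] at z2
  have lim : Tendsto (fun s => pfApprox y₁ y₂ s₁ s₂ A a₁ a₂ s + pfApprox y₁ y₂ s₁ s₂ B b₁ b₂ s)
      (𝓝[>] 0) (𝓝 (LA + LB)) := Tendsto.add pA pB
  have lim2 := (l1.add l2).neg
  refine tendsto_nhds_unique lim (lim2.congr' ?_)
  have hd0 : 0 < dist y₁ y₂ := dist_pos.2 hy
  have hlt : ∀ᶠ s in 𝓝[>] (0:ℝ), s < dist y₁ y₂ / 2 :=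
    nhdsWithin_le_nhds (eventually_lt_nhds (by positivity))
  filter_upwards [hlt, self_mem_nhdsWithin] with s hs hs0
  have hs0 : 0 < s := hs0
  have e := div_ext i y₁ y₂ s s hs0 hs0 (by linarith) H H' mH.smooth hp (IH s s hs0 hs0) hdec
  have e' : ∫ x in (Metric.closedBall y₁ s ∪ Metric.closedBall y₂ s)ᶜ, H' x
      = (∫ x in (Metric.closedBall y₁ s ∪ Metric.closedBall y₂ s)ᶜ, A x)
        + ∫ x in (Metric.closedBall y₁ s ∪ Metric.closedBall y₂ s)ᶜ, B x :=
    integral_add (IA s s hs0 hs0) (IB s s hs0 hs0)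
  rw [e'] at e
  rw [finsum_coeff_add mA.exp₁ mB.exp₁, finsum_coeff_add mA.exp₂ mB.exp₂]
  unfold pfApprox
  linear_combination -e - Real.log (s / s₁) * z1 - Real.log (s / s₂) * z2

/-- characterization of derivative operators satisfying the rule of
integration by parts on a class `S ⊆ 𝓕` closed under products and `∂_i`:
the rule holds iff `⟨D[F],G⟩ + ⟨D[G],F⟩` equals the surface term
`4π(n₁ⁱr₁²FG)₁ + 4π(n₂ⁱr₂²FG)₂`; the particular term `D^part` satisfies this
relation; and any `D` satisfying it differs from `D^part` by an antisymmetric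
functional. -/
theorem derivative_operator_characterization
    (y₁ y₂ : E3) (hy : y₁ ≠ y₂) (s₁ s₂ : ℝ) (hs₁ : 0 < s₁) (hs₂ : 0 < s₂)
    (i : Fin 3)
    (S : Set (E3 → ℝ))
    (cf₁ cf₂ : (E3 → ℝ) → ℝ → S2 → ℝ)
    -- every element of S lies in 𝓕 with integer exponents, coefficients cf₁, cf₂
    (hmem : ∀ F ∈ S, MemF y₁ y₂ F (cf₁ F) (cf₂ F))
    (hintc : ∀ F ∈ S, IntegerExponents (cf₁ F) ∧ IntegerExponents (cf₂ F))
    -- S is closed under products and under ∂_i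
    (hmul : ∀ F ∈ S, ∀ G ∈ S, (fun x => F x * G x) ∈ S)
    (hder : ∀ F ∈ S, pder i F ∈ S)
    -- decay fast enough at infinity that all the brackets exist
    (hdecay : ∀ F ∈ S, ∀ G ∈ S,
      Tendsto (fun x : E3 => ‖x‖ ^ 2 * (F x * G x)) (cocompact E3) (𝓝 0))
    (hintinf : ∀ F ∈ S, ∀ G ∈ S,
      ∃ R : ℝ, IntegrableOn (fun x => F x * G x) (Metric.closedBall 0 R)ᶜ volume)
    -- the brackets: ⟨PfF, G⟩ = B F G = Pf ∫ FG exists for all F, G ∈ S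
    (B : (E3 → ℝ) → (E3 → ℝ) → ℝ)
    (hB : ∀ F ∈ S, ∀ G ∈ S,
      HasPfIntegral y₁ y₂ s₁ s₂ (fun x => F x * G x)
        (cf₁ fun x => F x * G x) (cf₂ fun x => F x * G x) (B F G))
    -- a candidate distributional term D, with ⟨∂_i(PfF), G⟩ := B (∂_iF) G + ⟨D[F], G⟩
    (D : (E3 → ℝ) → (E3 → ℝ) → ℝ) :
    -- (1) the rule of integration by parts is equivalent to the symmetric relation
    ((∀ F ∈ S, ∀ G ∈ S, B (pder i F) G + D F G = -(B (pder i G) F + D G F))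
      ↔ (∀ F ∈ S, ∀ G ∈ S, D F G + D G F = surfaceTerm cf₁ cf₂ i F G))
    -- (2) the particular solution D^part satisfies the symmetric relation
    ∧ (∀ F ∈ S, ∀ G ∈ S,
        DpartBracket cf₁ cf₂ i F G + DpartBracket cf₁ cf₂ i G F
          = surfaceTerm cf₁ cf₂ i F G)
    -- (3) hence any D satisfying the rule is D^part plus an antisymmetric term
    ∧ ((∀ F ∈ S, ∀ G ∈ S, D F G + D G F = surfaceTerm cf₁ cf₂ i F G) →
        ∀ F ∈ S, ∀ G ∈ S,
          (D F G - DpartBracket cf₁ cf₂ i F G)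
            + (D G F - DpartBracket cf₁ cf₂ i G F) = 0) := by
  have h2 : ∀ F ∈ S, ∀ G ∈ S,
        DpartBracket cf₁ cf₂ i F G + DpartBracket cf₁ cf₂ i G F
          = surfaceTerm cf₁ cf₂ i F G := by
    intro F hF G hG
    have m := hmem _ (hmul F hF G hG)
    have d1 := dpart_one (hmem F hF).exp₁ (hmem G hG).exp₁ m.exp₁ (hintc F hF).1 i
    have d2 := dpart_one (hmem F hF).exp₂ (hmem G hG).exp₂ m.exp₂ (hintc F hF).2 i
    unfold DpartBracket surfaceTerm
    linarith
  have key : ∀ F ∈ S, ∀ G ∈ S, B (pder i F) G + B (pder i G) F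
      = - surfaceTerm cf₁ cf₂ i F G := by
    intro F hF G hG
    exact key_identity y₁ y₂ hy s₁ s₂ i F G _ _ _ _ _ _ _ _ (hmem F hF).smooth (hmem G hG).smooth
      rfl rfl (hmem _ (hmul F hF G hG)) (hmem _ (hmul _ (hder F hF) G hG))
      (hmem _ (hmul _ (hder G hG) F hF)) (hdecay F hF G hG) (hintinf _ (hder F hF) G hG)
      (hintinf _ (hder G hG) F hF) _ _ (hB _ (hder F hF) G hG) (hB _ (hder G hG) F hF)
  refine ⟨⟨fun h F hF G hG => ?_, fun h F hF G hG => ?_⟩, h2, fun h F hF G hG => ?_⟩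
  · have := h F hF G hG
    have := key F hF G hG
    linarith
  · have := h F hF G hG
    have := key F hF G hG
    linarith
  · have := h F hF G hG
    have := h2 F hF G hG
    linarith

end
end
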